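/- arXiv:q-alg/9608023 — 3 statements merged into one kernel-verified Lean document; each statement's English description precedes it below -/
import Mathlib

section
/- Let L be a unimodular lattice in ℝ^n. Then every characteristic vector w of L satisfies ⟪w,w⟫ ≡ n (mod 8), i.e. ⟪w,w⟫ − n ∈ 8ℤ. -/
open scoped RealInnerProductSpace

/-- A unimodular (self-dual) lattice in `ℝⁿ`: a `ℤ`-submodule of Euclidean space that is
discrete, spans `ℝⁿ` over `ℝ`, and is self-dual: a vector `v` belongs to the lattice iff
its inner product with every lattice vector is an integer. -/
def IsUnimodularLattice (n : ℕ) (L : Submodule ℤ (EuclideanSpace ℝ (Fin n))) : Prop :=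
  DiscreteTopology L ∧
  Submodule.span ℝ (L : Set (EuclideanSpace ℝ (Fin n))) = ⊤ ∧
  ∀ v : EuclideanSpace ℝ (Fin n), v ∈ L ↔ ∀ y ∈ L, ∃ k : ℤ, ⟪v, y⟫ = (k : ℝ)

/-- A characteristic vector of a lattice `L`: a vector `w ∈ L` with
`⟪w,x⟫ ≡ ⟪x,x⟫ (mod 2)` for all `x ∈ L`. -/
def IsCharacteristic (n : ℕ) (L : Submodule ℤ (EuclideanSpace ℝ (Fin n)))
    (w : EuclideanSpace ℝ (Fin n)) : Prop :=
  w ∈ L ∧ ∀ x ∈ L, ∃ k : ℤ, ⟪w, x⟫ - ⟪x, x⟫ = 2 * (k : ℝ)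

open Complex Filter Topology

theorem theta_lim (x c : ℝ) :
    Tendsto (fun δ : ℝ => jacobiTheta₂ (x:ℂ) (c + I / δ)) (𝓝[>] 0) (𝓝 1) := by
  have h1 : (1:ℂ) = ∑' n : ℤ, (if n = 0 then (1:ℂ) else 0) := by simp
  rw [h1]
  unfold jacobiTheta₂
  have him : ∀ δ : ℝ, ((c:ℂ) + I / δ).im = δ⁻¹ := by
    intro δ
    rw [div_eq_mul_inv, ← Complex.ofReal_inv]; simp
  have hb := summable_pow_mul_jacobiTheta₂_term_bound 0 one_pos 0
  simp only [pow_zero, one_mul] at hb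
  refine tendsto_tsum_of_dominated_convergence hb ?_ ?_
  · intro n
    by_cases hn : n = 0
    · subst hn; simp [jacobiTheta₂_term]
    · simp only [hn, if_false]
      rw [tendsto_zero_iff_norm_tendsto_zero]
      simp only [norm_jacobiTheta₂_term, him, ofReal_im, mul_zero, sub_zero]
      refine Real.tendsto_exp_atBot.comp ?_
      refine Tendsto.const_mul_atTop_of_neg ?_ tendsto_inv_nhdsGT_zero
      have : (0:ℝ) < (n:ℝ)^2 := by positivity
      nlinarith [Real.pi_pos]
  · have : ∀ᶠ δ : ℝ in 𝓝[>] 0, δ ∈ Set.Ioo (0:ℝ) 1 := Ioo_mem_nhdsGT one_pos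
    filter_upwards [this] with δ hδ n
    refine (norm_jacobiTheta₂_term_le (S := 0) (T := 1) one_pos (by rw [ofReal_im, abs_zero]) ?_ n).trans
      (by rw [one_mul])
    rw [him]
    exact (one_le_inv₀ hδ.1).2 hδ.2.le

theorem exp_pi_even {z : ℂ} (k : ℤ) (h : z = 2 * k) : cexp (Real.pi * I * z) = 1 := by
  rw [h, ← Complex.exp_int_mul_two_pi_mul_I k]; congr 1; ring

theorem exp_congr_even {y z : ℂ} (k : ℤ) (h : y = z + 2 * k) :
    cexp (Real.pi * I * y) = cexp (Real.pi * I * z) := by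
  rw [h, mul_add, Complex.exp_add, exp_pi_even k rfl, mul_one]

/-- One-dimensional quadratic Gauss sum. -/
noncomputable def gsum (a : ℕ) (m : ℤ) : ℂ :=
  ∑ k : Fin a, cexp (Real.pi * I * (((k:ℕ):ℂ)^2 + ((k:ℕ):ℂ) * m) / a)

theorem theta_class (a : ℕ) [NeZero a] (m : ℤ) (h : Even (m - a)) (u : ℂ) (hu : 0 < u.im) :
    jacobiTheta₂ (m / (2 * a)) (1 / a + u) = 1 / (-I * (a^2 * u)) ^ (1 / 2 : ℂ) *
      ∑ k : Fin a, cexp (Real.pi * I * (((k:ℕ):ℂ)^2 + ((k:ℕ):ℂ) * m) / a) *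
        jacobiTheta₂ ((((k:ℕ):ℝ) / a : ℝ) : ℂ) (-1 / (a^2 * u)) := by
  have ha : (a:ℂ) ≠ 0 := by exact_mod_cast NeZero.ne a
  have hu0 : u ≠ 0 := by rintro rfl; simp at hu
  have him : 0 < ((1:ℂ) / a + u).im := by
    have : ((1:ℂ)/a).im = 0 := by
      rw [show (1:ℂ)/a = ((1/a : ℝ) : ℂ) by push_cast; rfl, ofReal_im]
    rw [add_im, this]; simpa using hu
  have him2 : 0 < ((a:ℂ)^2 * u).im := by
    rw [show (a:ℂ)^2 = ((a^2 : ℝ) : ℂ) by push_cast; rfl, im_ofReal_mul]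
    have : (0:ℝ) < (a:ℝ)^2 := by
      have : (a:ℝ) ≠ 0 := by exact_mod_cast NeZero.ne a
      positivity
    positivity
  obtain ⟨d, hd⟩ := h
  have hm : (m:ℂ) = a + 2 * d := by
    have : m = a + 2 * d := by omega
    rw [this]; push_cast; ring
  have hs := hasSum_jacobiTheta₂_term ((m:ℂ) / (2 * a)) him
  have hs2 := (Equiv.hasSum_iff (Int.divModEquiv a).symm).2 hs
  have hterm : ∀ (j : ℤ) (k : Fin a),
      jacobiTheta₂_term (j * a + (k:ℕ)) ((m:ℂ) / (2 * a)) (1 / a + u) =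
      cexp (Real.pi * I * (((k:ℕ):ℂ)^2 + ((k:ℕ):ℂ) * m) / a) *
       cexp (Real.pi * I * ((k:ℕ):ℂ)^2 * u) *
        jacobiTheta₂_term j (((k:ℕ):ℂ) * a * u) (a^2 * u) := by
    intro j k
    unfold jacobiTheta₂_term
    rw [← Complex.exp_add, ← Complex.exp_add]
    have key := exp_pi_even (j * (k:ℕ) + (j*(j+1)/2) * a + j * d) rfl
    have hj : ((j*(j+1)/2 : ℤ) : ℂ) = j * (j+1) / 2 := by
      have h2 : 2 * (j*(j+1)/2) = j * (j+1) := Int.two_mul_ediv_two_of_even (Int.even_mul_succ_self j)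
      have h3 : (2:ℂ) * ((j*(j+1)/2 : ℤ) : ℂ) = j * (j+1) := by exact_mod_cast h2
      rw [← h3]; ring
    rw [← mul_one (cexp (_ + _ + _))]
    refine Eq.trans ?_ (congrArg _ key)
    rw [← Complex.exp_add]
    congr 1
    push_cast [hj]
    rw [hm]
    field_simp
    ring
  have hs3 : HasSum (fun p : ℤ × Fin a => 
      cexp (Real.pi * I * (((p.2:ℕ):ℂ)^2 + ((p.2:ℕ):ℂ) * m) / a) *
       cexp (Real.pi * I * ((p.2:ℕ):ℂ)^2 * u) *
        jacobiTheta₂_term p.1 (((p.2:ℕ):ℂ) * a * u) (a^2 * u))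
        (jacobiTheta₂ ((m:ℂ) / (2 * a)) (1 / a + u)) := by
    refine hs2.congr_fun ?_
    rintro ⟨j, k⟩
    have := hterm j k
    simp only [Function.comp]
    rw [← this]; rfl
  have hs4 := (Equiv.hasSum_iff (Equiv.prodComm (Fin a) ℤ)).2 hs3
  have hs5 := hs4.prod_fiberwise (fun k => 
    (hasSum_jacobiTheta₂_term (((k:ℕ):ℂ) * a * u) him2).mul_left 
      (cexp (Real.pi * I * (((k:ℕ):ℂ)^2 + ((k:ℕ):ℂ) * m) / a) *
       cexp (Real.pi * I * ((k:ℕ):ℂ)^2 * u)))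
  rw [hs5.unique (hasSum_fintype _), Finset.mul_sum]
  refine Finset.sum_congr rfl fun k _ => ?_
  rw [jacobiTheta₂_functional_equation]
  have e1 : ((k:ℕ):ℂ) * a * u / (a^2 * u) = ((((k:ℕ):ℝ) / a : ℝ) : ℂ) := by
    push_cast; field_simp
  have e2 : cexp (-Real.pi * I * (((k:ℕ):ℂ) * a * u)^2 / (a^2 * u)) =
      (cexp (Real.pi * I * ((k:ℕ):ℂ)^2 * u))⁻¹ := by
    rw [← Complex.exp_neg]; congr 1; field_simp
  rw [e1, e2]
  have := Complex.exp_ne_zero (Real.pi * I * ((k:ℕ):ℂ)^2 * u)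
  field_simp

theorem theta_pos (a : ℕ) [NeZero a] (m : ℤ) (h : Even (m - a)) (δ : ℝ) :
    ∃ r : ℝ, 0 ≤ r ∧
      jacobiTheta₂ ((m:ℂ) / (2 * a) * (a - I * δ)) (-(a - I * δ)) = r := by
  have ha : (a:ℂ) ≠ 0 := by exact_mod_cast NeZero.ne a
  refine ⟨∑' n : ℤ, Real.exp (Real.pi * δ * (n * m / a - n^2)), tsum_nonneg fun n => (Real.exp_pos _).le, ?_⟩
  rw [Complex.ofReal_tsum]
  unfold jacobiTheta₂
  refine tsum_congr fun n => ?_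
  obtain ⟨d, hd⟩ := h
  have hm : (m:ℂ) = a + 2 * d := by
    have : m = a + 2 * d := by omega
    rw [this]; push_cast; ring
  have hj : ((n*(n-1)/2 : ℤ) : ℂ) = n * (n-1) / 2 := by
    have h2 : 2 * (n*(n-1)/2) = n * (n-1) := Int.two_mul_ediv_two_of_even (Int.even_mul_pred_self n)
    have h3 : (2:ℂ) * ((n*(n-1)/2 : ℤ) : ℂ) = n * (n-1) := by exact_mod_cast h2
    rw [← h3]; ring
  have key := exp_pi_even (n * d - a * (n*(n-1)/2)) rfl
  rw [Complex.ofReal_exp, ← one_mul (cexp (ofReal _)), ← key, ← Complex.exp_add]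
  unfold jacobiTheta₂_term
  congr 1
  push_cast [hj]
  field_simp
  rw [hm]
  linear_combination (a * n^2 - n*(a+2*d)) * δ * I_sq

theorem real_mul_cpow_pos {r : ℝ} (hr : 0 < r) {x : ℂ} (hx : x ≠ 0) (c : ℂ) :
    ((r:ℂ) * x) ^ c = (r:ℂ) ^ c * x ^ c := by
  have hr' : (r:ℂ) ≠ 0 := by exact_mod_cast hr.ne'
  rw [Complex.cpow_def_of_ne_zero (mul_ne_zero hr' hx), Complex.cpow_def_of_ne_zero hr',
    Complex.cpow_def_of_ne_zero hx, Complex.log_ofReal_mul hr hx, Complex.ofReal_log hr.le,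
    ← Complex.exp_add, add_mul]

theorem gsum_phase (a : ℕ) [NeZero a] (m : ℤ) (h : Even (m - a)) :
    ∃ ρ : ℝ, 0 ≤ ρ ∧ gsum a m = ρ * cexp (Real.pi * I / 4 * (1 - m^2 / a)) := by
  have ha : (a:ℂ) ≠ 0 := by exact_mod_cast NeZero.ne a
  have haR : (0:ℝ) < a := by exact_mod_cast Nat.pos_of_ne_zero (NeZero.ne a)
  set V : ℝ → ℂ := fun δ => (1 / (a - I * δ)) ^ (1/2:ℂ) / (-I * (1 / (a - I * δ))) ^ (1/2:ℂ) *
    cexp (-Real.pi * I * (m / (2 * a))^2 * (a - I * δ)) with hV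
  have hne : ∀ δ : ℝ, (a - I * δ : ℂ) ≠ 0 := by
    intro δ h0
    have := congrArg Complex.re h0
    simp at this
    exact ha (by exact_mod_cast this)
  have hre : ∀ δ : ℝ, 0 < (1 / (a - I * δ) : ℂ).re := by
    intro δ
    rw [one_div, Complex.inv_re]
    refine div_pos ?_ (Complex.normSq_pos.2 (hne δ))
    simpa using haR
  have hVne : ∀ δ : ℝ, V δ ≠ 0 := by
    intro δ
    have h1 : (1 / (a - I * δ) : ℂ) ≠ 0 := one_div_ne_zero (hne δ)
    simp only [hV]
    refine mul_ne_zero (div_ne_zero ?_ ?_) (Complex.exp_ne_zero _)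
    · rw [Ne, Complex.cpow_eq_zero_iff]; tauto
    · rw [Ne, Complex.cpow_eq_zero_iff]
      have := mul_ne_zero (neg_ne_zero.2 I_ne_zero) h1
      tauto
  have hVc : ContinuousAt V 0 := by
    have c0 : ContinuousAt (fun δ : ℝ => (1 / (a - I * δ) : ℂ)) 0 := by
      refine ContinuousAt.div (by fun_prop) (by fun_prop) (hne 0)
    have c1 : ContinuousAt (fun δ : ℝ => (1 / (a - I * δ) : ℂ) ^ (1/2:ℂ)) 0 :=
      c0.cpow continuousAt_const (Or.inl (hre 0))
    have c2 : ContinuousAt (fun δ : ℝ => (-I * (1 / (a - I * δ)) : ℂ) ^ (1/2:ℂ)) 0 := by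
      refine (continuousAt_const.mul c0).cpow continuousAt_const (Or.inr ?_)
      have := hre 0
      change (-I * (1 / (a - I * (0:ℝ))) : ℂ).im ≠ 0
      rw [neg_mul, neg_im, I_mul_im]
      exact neg_ne_zero.2 this.ne'
    refine (c1.div c2 ?_).mul (by fun_prop)
    rw [Ne, Complex.cpow_eq_zero_iff]
    have := mul_ne_zero (neg_ne_zero.2 I_ne_zero) (one_div_ne_zero (hne 0))
    tauto
  have hV0 : V 0 = cexp (Real.pi * I / 4 * (1 - m^2 / a)) := by
    simp only [hV, ofReal_zero, mul_zero, sub_zero]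
    have e : (1 / (a:ℂ)) = ((1 / a : ℝ) : ℂ) := by push_cast; rfl
    have e1 : (-I * (1 / (a:ℂ))) ^ (1/2:ℂ) = (-I)^(1/2:ℂ) * (1/(a:ℂ))^(1/2:ℂ) := by
      rw [mul_comm, mul_comm ((-I)^_), e]
      exact real_mul_cpow_pos (by positivity) (neg_ne_zero.2 I_ne_zero) _
    have e2 : (-I)^(1/2:ℂ) = cexp (-(Real.pi * I / 4)) := by
      rw [Complex.cpow_def_of_ne_zero (neg_ne_zero.2 I_ne_zero), Complex.log_neg_I]
      congr 1; ring
    have e3 : (1/(a:ℂ))^(1/2:ℂ) ≠ 0 := by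
      rw [Ne, Complex.cpow_eq_zero_iff]
      have := one_div_ne_zero ha
      tauto
    rw [e1, e2, Complex.exp_neg]
    rw [show ∀ x y : ℂ, x ≠ 0 → x / (y⁻¹ * x) = y from fun x y hx => by field_simp]
    · rw [← Complex.exp_add]; congr 1; field_simp; ring
    · exact e3
  have hid : ∀ δ : ℝ, 0 < δ → ∃ r : ℝ, 0 ≤ r ∧
      ∑ k : Fin a, cexp (Real.pi * I * (((k:ℕ):ℂ)^2 + ((k:ℕ):ℂ) * m) / a) *
        jacobiTheta₂ ((((k:ℕ):ℝ) / a : ℝ) : ℂ) (((1 / a : ℝ) : ℂ) + I / δ) = V δ * r := by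
    intro δ hδ
    have hδ' : (δ:ℂ) ≠ 0 := by exact_mod_cast hδ.ne'
    obtain ⟨r, hr0, hr⟩ := theta_pos a m h δ
    have hd := hne δ
    have hu : 0 < (I * δ / (a * (a - I * δ)) : ℂ).im := by
      have : (I * δ / (a * (a - I * δ)) : ℂ) = ((δ / a : ℝ) : ℂ) * (I * (1 / (a - I * δ))) := by
        push_cast; field_simp
      rw [this, im_ofReal_mul, I_mul_im]
      have := hre δ
      positivity
    have H := theta_class a m h _ hu
    have t1 : (1 / a + I * δ / (a * (a - I * δ)) : ℂ) = 1 / (a - I * δ) := by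
      field_simp; ring
    have t2 : -I * ((a:ℂ)^2 * (I * δ / (a * (a - I * δ)))) = ((a * δ : ℝ) : ℂ) * (1 / (a - I * δ)) := by
      push_cast; field_simp; rw [I_sq]; ring
    have t3 : -1 / ((a:ℂ)^2 * (I * δ / (a * (a - I * δ)))) = ((1 / a : ℝ) : ℂ) + I / δ := by
      push_cast; field_simp; ring_nf; simp [I_sq]; try ring
    rw [t1, t2, t3, jacobiTheta₂_functional_equation] at H
    have t4 : -1 / (1 / (a - I * δ)) = -(a - I * δ : ℂ) := by field_simp
    have t5 : (m / (2 * a) : ℂ) / (1 / (a - I * δ)) = m / (2 * a) * (a - I * δ) := by field_simp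
    have t6 : -Real.pi * I * (m / (2 * a) : ℂ)^2 / (1 / (a - I * δ)) = 
      -Real.pi * I * (m / (2 * a))^2 * (a - I * δ) := by field_simp
    have haδ : 0 < a * δ := by positivity
    have t7 : (((a * δ : ℝ) : ℂ) * (1 / (a - I * δ))) ^ (1/2:ℂ) =
      ((Real.sqrt (a * δ) : ℝ) : ℂ) * (1 / (a - I * δ)) ^ (1/2:ℂ) := by
      rw [real_mul_cpow_pos haδ (one_div_ne_zero hd), Real.sqrt_eq_rpow, Complex.ofReal_cpow haδ.le]
      push_cast
      rfl
    rw [t4, t5, t6, hr, t7] at H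
    refine ⟨Real.sqrt (a * δ) * r, by positivity, ?_⟩
    have n1 : (1 / (a - I * δ) : ℂ) ^ (1/2:ℂ) ≠ 0 := by
      rw [Ne, Complex.cpow_eq_zero_iff]
      have := one_div_ne_zero hd
      tauto
    have n2 : ((Real.sqrt (a * δ) : ℝ) : ℂ) ≠ 0 := by
      exact_mod_cast (Real.sqrt_pos.2 haδ).ne'
    rw [one_div (_ * _), eq_comm, inv_mul_eq_iff_eq_mul₀ (mul_ne_zero n2 n1)] at H
    rw [H]
    simp only [hV]
    push_cast
    ring
  have hlim : Tendsto (fun δ : ℝ => (∑ k : Fin a, cexp (Real.pi * I * (((k:ℕ):ℂ)^2 + ((k:ℕ):ℂ) * m) / a) *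
        jacobiTheta₂ ((((k:ℕ):ℝ) / a : ℝ) : ℂ) (((1 / a : ℝ) : ℂ) + I / δ)) / V δ) (𝓝[>] 0)
        (𝓝 (gsum a m / V 0)) := by
    refine Tendsto.div ?_ (hVc.tendsto.mono_left nhdsWithin_le_nhds) (hVne 0)
    unfold gsum
    refine tendsto_finsetSum _ fun k _ => ?_
    simpa using (theta_lim (((k:ℕ):ℝ) / a) (1/a)).const_mul (cexp (Real.pi * I * (((k:ℕ):ℂ)^2 + ((k:ℕ):ℂ) * m) / a))
  have hcl : IsClosed (((↑) : ℝ → ℂ) '' Set.Ici (0:ℝ)) :=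
    Complex.isometry_ofReal.isClosedEmbedding.isClosedMap _ isClosed_Ici
  have hmem := hcl.mem_of_tendsto hlim (by
    filter_upwards [self_mem_nhdsWithin] with δ hδ
    obtain ⟨r, hr0, hr⟩ := hid δ hδ
    refine ⟨r, hr0, ?_⟩
    rw [hr, mul_div_cancel_left₀ _ (hVne δ)])
  obtain ⟨ρ, hρ, hρe⟩ := hmem
  refine ⟨ρ, hρ, ?_⟩
  rw [← hV0, hρe, div_mul_cancel₀ _ (hVne 0)]

theorem sum_eq_card {A : Type*} [AddCommGroup A] [Fintype A] [DecidableEq A] (S : Finset A)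
    (hadd : ∀ x ∈ S, ∀ y ∈ S, x + y ∈ S) (hne : S.Nonempty) (Q : A → ℂ) (B : A → A → ℂ)
    (hQB : ∀ k, ∀ h ∈ S, Q (k + h) = Q k * B k h)
    (hB : ∀ k, ∀ h ∈ S, ∀ h' ∈ S, B k (h + h') = B k h * B k h')
    (hd : ∀ k, (∀ h ∈ S, B k h = 1) → k ∈ S)
    (hQ : ∀ k ∈ S, Q k = 1) (hB1 : ∀ k ∈ S, ∀ h ∈ S, B k h = 1) :
    ∑ k, Q k = S.card := by
  have hc : (S.card : ℂ) ≠ 0 := by exact_mod_cast hne.card_pos.ne'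
  have hinner : ∀ k, Q k * ∑ h ∈ S, B k h = if k ∈ S then (S.card : ℂ) else 0 := by
    intro k
    split_ifs with hk
    · rw [hQ k hk, one_mul, Finset.sum_congr rfl (fun h hh => hB1 k hk h hh)]; simp
    · have : ∃ h0 ∈ S, B k h0 ≠ 1 := by
        by_contra hcon
        push Not at hcon
        exact hk (hd k hcon)
      obtain ⟨h0, h0S, h01⟩ := this
      have himg : S.image (fun x => h0 + x) = S := by
        refine Finset.eq_of_subset_of_card_le ?_ ?_
        · intro x hx
          obtain ⟨y, hy, rfl⟩ := Finset.mem_image.1 hx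
          exact hadd _ h0S _ hy
        · rw [Finset.card_image_of_injective _ (add_right_injective h0)]
      have h1 : ∑ h ∈ S, B k h = B k h0 * ∑ h ∈ S, B k h := by
        conv_lhs => rw [← himg]
        rw [Finset.sum_image (fun x _ y _ hxy => add_right_injective h0 hxy), Finset.mul_sum]
        exact Finset.sum_congr rfl fun h hh => hB k h0 h0S h hh
      have h2 : (1 - B k h0) * ∑ h ∈ S, B k h = 0 := by linear_combination h1
      rcases mul_eq_zero.1 h2 with h3 | h3
      · exact absurd (by linear_combination -h3) h01
      · rw [h3, mul_zero]
  have h1 : ∀ h ∈ S, ∑ k, Q k = ∑ k, Q k * B k h := by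
    intro h hh
    rw [← Equiv.sum_comp (Equiv.addRight h) Q]
    exact Finset.sum_congr rfl fun k _ => hQB k h hh
  have h2 : (S.card : ℂ) * ∑ k, Q k = S.card * S.card := by
    calc (S.card : ℂ) * ∑ k, Q k = ∑ h ∈ S, ∑ k, Q k := by simp
      _ = ∑ h ∈ S, ∑ k, Q k * B k h := Finset.sum_congr rfl h1
      _ = ∑ k, Q k * ∑ h ∈ S, B k h := by
        rw [Finset.sum_comm]; simp only [Finset.mul_sum]
      _ = S.card * S.card := by
        simp only [hinner]; simp
  exact mul_left_cancel₀ hc h2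

theorem exists_orth (n : ℕ) (L : Submodule ℤ (EuclideanSpace ℝ (Fin n)))
    (hspan : Submodule.span ℝ (L : Set (EuclideanSpace ℝ (Fin n))) = ⊤)
    (hinteg : ∀ x ∈ L, ∀ y ∈ L, ∃ k : ℤ, ⟪x, y⟫ = (k : ℝ)) (k : ℕ) (hk : k ≤ n) :
    ∃ e : Fin k → EuclideanSpace ℝ (Fin n), (∀ i, e i ∈ L) ∧ (∀ i, e i ≠ 0) ∧
      ∀ i j, i ≠ j → ⟪e i, e j⟫ = 0 := by
  induction k with
  | zero => exact ⟨Fin.elim0, fun i => i.elim0, fun i => i.elim0, fun i => i.elim0⟩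
  | succ k ih =>
    obtain ⟨e, heL, he0, heo⟩ := ih (by omega)
    have h1 : ∃ v ∈ L, v ∉ Submodule.span ℝ (Set.range e) := by
      by_contra hcon
      push Not at hcon
      have h2 : Submodule.span ℝ (Set.range e) = ⊤ := by
        rw [eq_top_iff, ← hspan]
        exact Submodule.span_le.2 hcon
      have h3 := finrank_range_le_card (R := ℝ) e
      rw [Set.finrank, h2, finrank_top, finrank_euclideanSpace_fin, Fintype.card_fin] at h3
      omega
    obtain ⟨v, hvL, hv⟩ := h1
    choose a ha using fun i => hinteg (e i) (heL i) (e i) (heL i)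
    choose c hc using fun i => hinteg (e i) (heL i) v hvL
    have ha0 : ∀ i, a i ≠ 0 := by
      intro i h
      have h2 := ha i
      rw [h, Int.cast_zero, inner_self_eq_zero] at h2
      exact he0 i h2
    set N : ℤ := ∏ j, a j with hN
    set d : Fin k → ℤ := fun i => (∏ j ∈ Finset.univ.erase i, a j) * c i with hd
    have hN0 : N ≠ 0 := Finset.prod_ne_zero_iff.2 fun i _ => ha0 i
    have hda : ∀ i, d i * a i = N * c i := by
      intro i
      rw [hN, ← Finset.prod_erase_mul _ _ (Finset.mem_univ i)]
      simp only [hd]; ring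
    set v' := N • v - ∑ i, d i • e i with hv'
    have hv'L : v' ∈ L :=
      L.sub_mem (L.smul_mem _ hvL) (L.sum_mem fun i _ => L.smul_mem _ (heL i))
    have horth : ∀ i, ⟪e i, v'⟫ = 0 := by
      intro i
      simp only [hv', ← Int.cast_smul_eq_zsmul ℝ]
      rw [inner_sub_right, inner_sum, Finset.sum_eq_single i]
      · rw [inner_smul_right, inner_smul_right, ha, hc]
        have := hda i
        rw [sub_eq_zero]
        exact_mod_cast this.symm
      · intro j _ hj
        rw [inner_smul_right, heo i j hj.symm, mul_zero]
      · simp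
    have hv'0 : v' ≠ 0 := by
      intro h0
      apply hv
      have h2 : (N:ℝ) • v = ∑ i, (d i : ℝ) • e i := by
        simp only [Int.cast_smul_eq_zsmul]
        exact sub_eq_zero.1 h0
      have h3 : (N:ℝ) • v ∈ Submodule.span ℝ (Set.range e) := by
        rw [h2]
        exact Submodule.sum_mem _ fun i _ => Submodule.smul_mem _ _ (Submodule.subset_span ⟨i, rfl⟩)
      exact (Submodule.smul_mem_iff _ (by exact_mod_cast hN0)).1 h3
    refine ⟨Fin.cons v' e, ?_, ?_, ?_⟩
    · intro i; refine Fin.cases ?_ (fun j => ?_) i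
      · simpa using hv'L
      · simpa using heL j
    · intro i; refine Fin.cases ?_ (fun j => ?_) i
      · simpa using hv'0
      · simpa using he0 j
    · intro i j
      refine Fin.cases ?_ (fun i' => ?_) i <;> refine Fin.cases ?_ (fun j' => ?_) j
      · simp
      · intro _; simpa [real_inner_comm] using horth j'
      · intro _; simpa using horth i'
      · intro h; simpa using heo i' j' (by simpa using h)

/-- Every characteristic vector `w` of a unimodular lattice in `ℝⁿ` satisfies
`⟪w,w⟫ ≡ n (mod 8)`. -/
theorem characteristic_norm_congruent_rank_mod_eight (n : ℕ)
    (L : Submodule ℤ (EuclideanSpace ℝ (Fin n))) (hL : IsUnimodularLattice n L)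
    (w : EuclideanSpace ℝ (Fin n)) (hw : IsCharacteristic n L w) :
    ∃ k : ℤ, ⟪w, w⟫ - (n : ℝ) = 8 * (k : ℝ) := by
  classical
  obtain ⟨-, hspan, hdual⟩ := hL
  obtain ⟨hwL, hchar⟩ := hw
  have hinteg : ∀ x ∈ L, ∀ y ∈ L, ∃ k : ℤ, ⟪x, y⟫ = (k : ℝ) := fun x hx => (hdual x).1 hx
  obtain ⟨e, heL, he0, heo⟩ := exists_orth n L hspan hinteg n le_rfl
  have hapos : ∀ i, ∃ a : ℕ, a ≠ 0 ∧ ⟪e i, e i⟫ = (a:ℝ) := by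
    intro i
    obtain ⟨z, hz⟩ := hinteg (e i) (heL i) (e i) (heL i)
    have hp : 0 < ⟪e i, e i⟫ := real_inner_self_pos.2 (he0 i)
    rw [hz] at hp
    have hp' : 0 < z := by exact_mod_cast hp
    lift z to ℕ using hp'.le
    exact ⟨z, by omega, by simpa using hz⟩
  choose a ha0 ha using hapos
  haveI : ∀ i, NeZero (a i) := fun i => ⟨ha0 i⟩
  have haR : ∀ i, (a i : ℝ) ≠ 0 := fun i => by exact_mod_cast ha0 i
  choose m hm using fun i => hinteg (e i) (heL i) w hwL
  -- inner products of combinations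
  have hcomb : ∀ (c : Fin n → ℝ) i, ⟪e i, ∑ j, c j • e j⟫ = a i * c i := by
    intro c i
    rw [inner_sum, Finset.sum_eq_single i]
    · rw [inner_smul_right, ha]; ring
    · intro j _ hj
      rw [inner_smul_right, heo i j hj.symm, mul_zero]
    · simp
  -- expansion
  have hli : LinearIndependent ℝ e := linearIndependent_of_ne_zero_of_inner_eq_zero he0
    (fun i j hij => heo i j hij)
  have htop : Submodule.span ℝ (Set.range e) = ⊤ :=
    hli.span_eq_top_of_card_eq_finrank' (by simp)
  have hexp : ∀ v, v = ∑ i, (⟪e i, v⟫ / a i) • e i := by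
    intro v
    rw [← sub_eq_zero]
    set z := v - ∑ i, (⟪e i, v⟫ / a i) • e i with hz
    have h1 : ∀ i, ⟪e i, z⟫ = 0 := by
      intro i
      rw [hz, inner_sub_right, hcomb]
      have := haR i
      field_simp
      ring
    have h2 : ∀ y ∈ Submodule.span ℝ (Set.range e), ⟪y, z⟫ = 0 := by
      intro y hy
      induction hy using Submodule.span_induction with
      | mem x hx => obtain ⟨i, rfl⟩ := hx; exact h1 i
      | zero => simp
      | add x y _ _ hx hy => rw [inner_add_left, hx, hy, add_zero]
      | smul c x _ hx => rw [inner_smul_left, hx, mul_zero]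
    exact inner_self_eq_zero.1 (h2 z (htop ▸ Submodule.mem_top))
  have hinner : ∀ u v, ⟪u, v⟫ = ∑ i, ⟪e i, u⟫ * ⟪e i, v⟫ / a i := by
    intro u v
    conv_lhs => rw [hexp u]
    rw [sum_inner]
    refine Finset.sum_congr rfl fun i _ => ?_
    rw [real_inner_smul_left]; ring
  -- the sublattice generated by the `e i`
  set L' : Set (EuclideanSpace ℝ (Fin n)) := {z | ∀ i, ∃ c : ℤ, ⟪e i, z⟫ = a i * c} with hL'
  set D : Set (EuclideanSpace ℝ (Fin n)) := {z | ∀ i, ∃ c : ℤ, ⟪e i, z⟫ = c} with hD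
  have hL'L : ∀ z ∈ L', z ∈ L := by
    intro z hz
    choose c hc using hz
    have : z = ∑ i, c i • e i := by
      rw [hexp z]
      refine Finset.sum_congr rfl fun i _ => ?_
      rw [hc, mul_div_cancel_left₀ _ (haR i), Int.cast_smul_eq_zsmul]
    rw [this]
    exact L.sum_mem fun i _ => L.smul_mem _ (heL i)
  have hLD : ∀ z ∈ L, z ∈ D := fun z hz i => hinteg (e i) (heL i) z hz
  have hDL' : ∀ x ∈ D, ∀ z ∈ L', ∃ c : ℤ, ⟪x, z⟫ = c := by
    intro x hx z hz
    choose c hc using hx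
    choose d hd using hz
    refine ⟨∑ i, c i * d i, ?_⟩
    rw [hinner]
    push_cast
    refine Finset.sum_congr rfl fun i _ => ?_
    rw [hc, hd]
    have := haR i
    field_simp
  set q : EuclideanSpace ℝ (Fin n) → ℂ := fun z =>
    cexp (Real.pi * I * ((⟪z, z⟫ + ⟪w, z⟫ : ℝ) : ℂ)) with hq
  have hqL : ∀ z ∈ L, ∃ k : ℤ, ⟪z, z⟫ + ⟪w, z⟫ = 2 * (k:ℝ) := by
    intro z hz
    obtain ⟨k, hk⟩ := hchar z hz
    obtain ⟨l, hl⟩ := hinteg z hz z hz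
    refine ⟨k + l, ?_⟩
    push_cast
    linarith
  have hqadd : ∀ x, ∀ z ∈ L, q (x + z) = q x * cexp (Real.pi * I * ((2 * ⟪x, z⟫ : ℝ) : ℂ)) := by
    intro x z hz
    obtain ⟨k, hk⟩ := hqL z hz
    simp only [hq]
    rw [← Complex.exp_add, ← mul_add, ← Complex.ofReal_add]
    apply exp_congr_even k
    have : ⟪x + z, x + z⟫ + ⟪w, x + z⟫ = ⟪x, x⟫ + ⟪w, x⟫ + 2 * ⟪x, z⟫ + 2 * (k:ℝ) := by
      rw [← hk, inner_add_right, inner_add_left, inner_add_left, inner_add_right,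
        real_inner_comm x z]
      ring
    rw [this]; push_cast; ring
  have hqL' : ∀ x ∈ D, ∀ z ∈ L', q (x + z) = q x := by
    intro x hx z hz
    obtain ⟨c, hc⟩ := hDL' x hx z hz
    rw [hqadd x z (hL'L z hz), exp_pi_even c (by rw [hc]; push_cast; ring), mul_one]
  -- the finite group
  set X : (∀ i, Fin (a i)) → EuclideanSpace ℝ (Fin n) := fun k =>
    ∑ i, (((k i : ℕ) : ℝ) / a i) • e i with hX
  have heX : ∀ k i, ⟪e i, X k⟫ = ((k i : ℕ) : ℝ) := by
    intro k i
    simp only [hX]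
    rw [hcomb, mul_div_cancel₀ _ (haR i)]
  have hXD : ∀ k, X k ∈ D := fun k i => ⟨(k i : ℕ), by rw [heX]; simp⟩
  have hXadd : ∀ k h, ∃ z ∈ L', X (k + h) = X k + X h + z := by
    intro k h
    refine ⟨X (k + h) - (X k + X h), ?_, by abel⟩
    intro i
    refine ⟨-(((k i : ℕ) + (h i : ℕ)) / a i : ℕ), ?_⟩
    rw [inner_sub_right, inner_add_right, heX, heX, heX, Pi.add_apply, Fin.val_add]
    have := Nat.mod_add_div ((k i : ℕ) + (h i : ℕ)) (a i)
    have h2 : (((((k i : ℕ) + (h i : ℕ)) % a i : ℕ) : ℝ) + a i * ((((k i : ℕ) + (h i : ℕ)) / a i : ℕ) : ℝ))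
      = (k i : ℕ) + (h i : ℕ) := by exact_mod_cast this
    rw [Int.cast_neg, Int.cast_natCast]
    linarith
  have hXsurj : ∀ y ∈ L, ∃ k, ∃ z ∈ L', y = X k + z := by
    intro y hy
    choose c hc using hLD y hy
    have hpos : ∀ i, (0:ℤ) < a i := fun i => by exact_mod_cast Nat.pos_of_ne_zero (ha0 i)
    refine ⟨fun i => ⟨(c i % a i).toNat, by
      have h1 := Int.emod_lt_of_pos (c i) (hpos i)
      have h2 := Int.emod_nonneg (c i) (hpos i).ne'
      omega⟩, _, ?_, (add_sub_cancel _ _).symm⟩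
    intro i
    refine ⟨c i / a i, ?_⟩
    rw [inner_sub_right, heX, hc]
    have h2 := Int.emod_nonneg (c i) (hpos i).ne'
    have h3 : (((c i % a i).toNat : ℕ) : ℝ) = ((c i % a i : ℤ) : ℝ) := by
      rw [← Int.cast_natCast, Int.toNat_of_nonneg h2]
    simp only [h3]
    have h4 : (((c i % a i : ℤ) : ℝ) + a i * ((c i / a i : ℤ) : ℝ)) = c i := by
      exact_mod_cast Int.emod_add_mul_ediv (c i) (a i)
    linarith
  set S : Finset (∀ i, Fin (a i)) := Finset.univ.filter fun k => X k ∈ L with hS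
  have hmS : ∀ k, k ∈ S ↔ X k ∈ L := fun k => by simp [hS]
  have hsum : ∑ k, q (X k) = S.card := by
    refine sum_eq_card S ?_ ⟨0, ?_⟩ (fun k => q (X k))
      (fun k h => cexp (Real.pi * I * ((2 * ⟪X k, X h⟫ : ℝ) : ℂ))) ?_ ?_ ?_ ?_ ?_
    · intro x hx y hy
      rw [hmS] at *
      obtain ⟨z, hz, hz'⟩ := hXadd x y
      rw [hz']
      exact L.add_mem (L.add_mem hx hy) (hL'L z hz)
    · rw [hmS]
      have : X 0 = 0 := by simp [hX]
      rw [this]; exact L.zero_mem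
    · intro k h hh
      rw [hmS] at hh
      obtain ⟨z, hz, hz'⟩ := hXadd k h
      have hD2 : X k + X h ∈ D := by
        intro i
        refine ⟨(k i : ℕ) + (h i : ℕ), ?_⟩
        rw [inner_add_right, heX, heX]; push_cast; rfl
      change q (X (k + h)) = _
      rw [hz', hqL' _ hD2 z hz, hqadd _ _ hh]
    · intro k h _ h' _
      obtain ⟨z, hz, hz'⟩ := hXadd h h'
      obtain ⟨c, hc⟩ := hDL' (X k) (hXD k) z hz
      change cexp _ = cexp _ * cexp _
      rw [← Complex.exp_add, ← mul_add]
      apply exp_congr_even c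
      rw [hz', inner_add_right, inner_add_right, hc]
      push_cast; ring
    · intro k hk
      rw [hmS, hdual]
      intro y hy
      obtain ⟨h, z, hz, hyz⟩ := hXsurj y hy
      have hXh : X h ∈ L := by
        have : X h = y - z := by rw [hyz]; abel
        rw [this]; exact L.sub_mem hy (hL'L z hz)
      have h1 := hk h ((hmS h).2 hXh)
      obtain ⟨l, hl⟩ := Complex.exp_eq_one_iff.1 h1
      obtain ⟨c, hc⟩ := hDL' (X k) (hXD k) z hz
      have hl' : ⟪X k, X h⟫ = (l:ℝ) := by
        have h2 : (2 * Real.pi * I : ℂ) ≠ 0 := Complex.two_pi_I_ne_zero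
        have h3 : ((⟪X k, X h⟫ : ℝ) : ℂ) = l := by
          apply mul_left_cancel₀ h2
          push_cast at hl
          linear_combination hl
        exact_mod_cast h3
      refine ⟨l + c, ?_⟩
      rw [hyz, inner_add_right, hl', hc]; push_cast; rfl
    · intro k hk
      obtain ⟨l, hl⟩ := hqL (X k) ((hmS k).1 hk)
      exact exp_pi_even l (by rw [hl]; push_cast; rfl)
    · intro k hk h hh
      obtain ⟨l, hl⟩ := hinteg _ ((hmS k).1 hk) _ ((hmS h).1 hh)
      exact exp_pi_even l (by rw [hl]; push_cast; rfl)
  have hprod : ∏ i, gsum (a i) (m i) = S.card := by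
    rw [← hsum]
    simp only [gsum]
    rw [Finset.prod_univ_sum, Fintype.piFinset_univ]
    refine Finset.sum_congr rfl fun k _ => ?_
    rw [← Complex.exp_sum]
    simp only [hq]
    congr 1
    rw [hinner (X k), hinner w, ← Finset.sum_add_distrib]
    push_cast
    rw [Finset.mul_sum]
    refine Finset.sum_congr rfl fun i _ => ?_
    rw [heX, hm]
    push_cast
    ring
  have hev : ∀ i, Even (m i - a i) := by
    intro i
    obtain ⟨l, hl⟩ := hchar (e i) (heL i)
    rw [real_inner_comm, hm, ha] at hl
    refine ⟨l, ?_⟩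
    have : (m i - a i : ℤ) = 2 * l := by exact_mod_cast hl
    omega
  choose ρ hρ0 hρ using fun i => gsum_phase (a i) (m i) (hev i)
  have hsumph : ∑ i, (1 - (m i : ℝ)^2 / a i) = n - ⟪w, w⟫ := by
    rw [hinner w w, Finset.sum_sub_distrib]
    simp only [hm]
    simp [sq]
  have hfin : ((∏ i, ρ i : ℝ) : ℂ) * cexp (((Real.pi / 4 * (n - ⟪w, w⟫) : ℝ) : ℂ) * I) = S.card := by
    rw [← hprod, Finset.prod_congr rfl fun i _ => hρ i, Finset.prod_mul_distrib, ← Complex.exp_sum,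
      ← Finset.mul_sum, ← hsumph]
    push_cast
    congr 2
    ring
  have hcard : 0 < S.card := Finset.card_pos.2 ⟨0, by
    rw [hmS]
    have : X 0 = 0 := by simp [hX]
    rw [this]; exact L.zero_mem⟩
  have hnorm := congrArg norm hfin
  rw [norm_mul, Complex.norm_exp_ofReal_mul_I, mul_one, Complex.norm_real, Complex.norm_natCast,
    Real.norm_of_nonneg (Finset.prod_nonneg fun i _ => hρ0 i)] at hnorm
  rw [hnorm, Complex.ofReal_natCast] at hfin
  have hone : cexp (((Real.pi / 4 * (n - ⟪w, w⟫) : ℝ) : ℂ) * I) = 1 := by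
    apply mul_left_cancel₀ (show (S.card : ℂ) ≠ 0 by exact_mod_cast hcard.ne')
    rw [hfin, mul_one]
  obtain ⟨l, hl⟩ := Complex.exp_eq_one_iff.1 hone
  refine ⟨-l, ?_⟩
  have h3 : ((Real.pi / 4 * (n - ⟪w, w⟫) : ℝ) : ℂ) = ((l * (2 * Real.pi) : ℝ) : ℂ) := by
    apply mul_right_cancel₀ I_ne_zero
    rw [hl]; push_cast; ring
  have h4 := Complex.ofReal_injective h3
  have h5 := Real.pi_pos
  push_cast
  apply mul_left_cancel₀ h5.ne'
  linarith
end

section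
/- Every unimodular lattice L in ℝ^n has a characteristic vector of norm at most n: there exists a characteristic vector w of L with ⟪w,w⟫ ≤ n. -/
open scoped RealInnerProductSpace

section Analysis
open MeasureTheory FourierTransform Module

variable {n : ℕ} {L : Submodule ℤ (EuclideanSpace ℝ (Fin n))}

theorem ucv_summable_zero [DiscreteTopology L] [IsZLattice ℝ L] {a : ℝ} (ha : 0 < a) :
    Summable fun l : L => Real.exp (-a * ‖(l : EuclideanSpace ℝ (Fin n))‖ ^ 2) := by
  set N := Module.finrank ℤ L + 1
  have h1 := (ZLattice.summable_norm_pow_inv L (2 * N) (by omega)).mul_left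
    ((N.factorial : ℝ) / a ^ N)
  refine Summable.of_norm_bounded_eventually h1 ?_
  have hfin : ({0} : Set L).Finite := Set.finite_singleton 0
  refine hfin.subset ?_
  intro l hl
  by_contra hne
  apply hl
  simp only [Set.mem_singleton_iff] at hne
  have hpos : 0 < ‖(l : EuclideanSpace ℝ (Fin n))‖ := by
    rw [norm_pos_iff]; simpa using hne
  simp only [Submodule.norm_coe, Set.mem_ofPred_eq]
  rw [Real.norm_eq_abs, abs_of_pos (Real.exp_pos _)]
  set s := ‖l‖ with hs
  have hpos' : 0 < s := hpos
  have h2 := Real.pow_div_factorial_le_exp (a * s ^ 2) (by positivity) N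
  rw [neg_mul, Real.exp_neg]
  have h3 : (N.factorial : ℝ) / a ^ N * s⁻¹ ^ (2 * N) = ((a * s ^ 2) ^ N / N.factorial)⁻¹ := by
    rw [mul_pow, ← pow_mul, inv_div, inv_pow]; field_simp
  rw [h3]
  exact inv_anti₀ (by positivity) h2

theorem ucv_norm_ge (v x : EuclideanSpace ℝ (Fin n)) :
    ‖x‖ ^ 2 / 2 - ‖v‖ ^ 2 ≤ ‖v + x‖ ^ 2 := by
  have h : ‖x‖ ≤ ‖v + x‖ + ‖v‖ := by
    have := norm_sub_le (v + x) v
    simpa using this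
  nlinarith [norm_nonneg x, norm_nonneg v, norm_nonneg (v + x), sq_nonneg (‖v + x‖ - ‖v‖)]

theorem ucv_exp_le {a R : ℝ} (ha : 0 ≤ a) {v : EuclideanSpace ℝ (Fin n)} (hv : ‖v‖ ≤ R)
    (x : EuclideanSpace ℝ (Fin n)) :
    Real.exp (-a * ‖v + x‖ ^ 2) ≤ Real.exp (a * R ^ 2) * Real.exp (-(a / 2) * ‖x‖ ^ 2) := by
  rw [← Real.exp_add]
  apply Real.exp_le_exp.2
  have h1 := ucv_norm_ge v x
  have h2 : ‖v‖ ^ 2 ≤ R ^ 2 := by gcongr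
  nlinarith

theorem ucv_summable [DiscreteTopology L] [IsZLattice ℝ L] {a : ℝ} (ha : 0 < a)
    (v : EuclideanSpace ℝ (Fin n)) :
    Summable fun l : L => Real.exp (-a * ‖v + (l : EuclideanSpace ℝ (Fin n))‖ ^ 2) :=
  Summable.of_nonneg_of_le (fun _ => (Real.exp_pos _).le)
    (fun l => ucv_exp_le ha.le (le_refl ‖v‖) l)
    ((ucv_summable_zero (half_pos ha)).mul_left _)

theorem ucv_norm_cexp (c : ℂ) (r : ℝ) :
    ‖Complex.exp (-c * r ^ 2)‖ = Real.exp (-c.re * r ^ 2) := by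
  rw [Complex.norm_exp]
  congr 1
  simp [← Complex.ofReal_pow]

theorem ucv_continuous_tsum [DiscreteTopology L] [IsZLattice ℝ L] {c : ℂ} (hc : 0 < c.re) :
    Continuous fun v : EuclideanSpace ℝ (Fin n) =>
      ∑' l : L, Complex.exp (-c * ‖v + (l : EuclideanSpace ℝ (Fin n))‖ ^ 2) := by
  rw [continuous_iff_continuousAt]
  intro v₀
  have : ContinuousOn (fun v : EuclideanSpace ℝ (Fin n) =>
      ∑' l : L, Complex.exp (-c * ‖v + (l : EuclideanSpace ℝ (Fin n))‖ ^ 2))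
      (Metric.ball 0 (‖v₀‖ + 1)) := by
    refine continuousOn_tsum (u := fun l : L => Real.exp (c.re * (‖v₀‖ + 1) ^ 2) *
      Real.exp (-(c.re / 2) * ‖(l : EuclideanSpace ℝ (Fin n))‖ ^ 2)) ?_ ?_ ?_
    · intro l
      fun_prop
    · exact (ucv_summable_zero (half_pos hc)).mul_left _
    · intro l v hv
      rw [ucv_norm_cexp]
      apply ucv_exp_le hc.le
      simpa using (mem_ball_zero_iff.1 hv).le
  exact this.continuousAt (Metric.isOpen_ball.mem_nhds (by simp))

theorem ucv_poisson [DiscreteTopology L] [IsZLattice ℝ L] {ι : Type} [Fintype ι]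
    (b : Basis ι ℤ L) (D : (ι → ℤ) → EuclideanSpace ℝ (Fin n))
    (hD : ∀ m v, ⟪v, D m⟫ = ∑ i, (m i : ℝ) * (b.ofZLatticeBasis ℝ L).repr v i) :
    ∃ κ : ℝ, 0 ≤ κ ∧ ∀ f : EuclideanSpace ℝ (Fin n) → ℂ, Integrable f →
      Continuous (fun v => ∑' l : L, f (v + l)) → (Summable fun m => 𝓕 f (D m)) →
      ∀ v, ∑' l : L, f (v + l) =
        κ * ∑' m, 𝓕 f (D m) * Complex.exp (2 * Real.pi * Complex.I * ⟪v, D m⟫) := by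
  classical
  set bE := b.ofZLatticeBasis ℝ L with hbE
  set B : (ι → ℝ) ≃L[ℝ] EuclideanSpace ℝ (Fin n) := bE.equivFun.symm.toContinuousLinearEquiv
    with hB
  have hBr : ∀ x i, bE.repr (B x) i = x i := by
    intro x i
    have : bE.equivFun (B x) = x := bE.equivFun.apply_symm_apply x
    exact congrFun this i
  set μ : Measure (EuclideanSpace ℝ (Fin n)) := Measure.map B volume with hμ
  have hBe : MeasurableEmbedding B := B.toHomeomorph.measurableEmbedding
  have : μ.IsAddHaarMeasure := B.isAddHaarMeasure_map volume
  have hμv := Measure.isAddLeftInvariant_eq_smul μ volume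
  set κ := Measure.addHaarScalarFactor μ volume with hκ
  -- character on E
  set e : (ι → ℤ) → EuclideanSpace ℝ (Fin n) → ℂ :=
    fun m v => Complex.exp (2 * Real.pi * Complex.I * ⟪v, D m⟫) with he
  have hmF : ∀ (m : ι → ℤ) (x : ι → ℝ),
      UnitAddTorus.mFourier m (fun i => (x i : UnitAddCircle)) = e m (B x) := by
    intro m x
    simp only [UnitAddTorus.mFourier, ContinuousMap.coe_mk, fourier_coe_apply, he]
    rw [← Complex.exp_sum, hD]
    congr 1
    simp only [hBr]
    push_cast
    rw [Finset.mul_sum]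
    refine Finset.sum_congr rfl fun i _ => ?_
    simp
    ring
  have hadd : ∀ m (l : L) v, e m (v + l) = e m v := by
    intro m l v
    simp only [he]
    rw [inner_add_left, hD m (l : EuclideanSpace ℝ (Fin n))]
    have : (∑ i, (m i : ℝ) * bE.repr (l : EuclideanSpace ℝ (Fin n)) i) =
        ((∑ i, m i * b.repr l i : ℤ) : ℝ) := by
      push_cast
      refine Finset.sum_congr rfl fun i _ => ?_
      rw [hbE, Basis.ofZLatticeBasis_repr_apply]
    rw [this]
    push_cast
    rw [mul_add, Complex.exp_add]
    have := Complex.exp_int_mul_two_pi_mul_I (∑ i, m i * b.repr l i)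
    push_cast at this
    rw [mul_comm (2 * (Real.pi : ℂ) * Complex.I) (∑ i, (m i : ℂ) * (b.repr l i : ℂ)), this, mul_one]
  refine ⟨κ, κ.2, ?_⟩
  intro f hfi hΦ hsum v
  set Φ : EuclideanSpace ℝ (Fin n) → ℂ := fun v => ∑' l : L, f (v + l) with hΦdef
  have hper : ∀ (l : L) v, Φ (v + l) = Φ v := by
    intro l v
    simp only [hΦdef]
    rw [← (Equiv.addLeft l).tsum_eq (fun l' : L => f (v + l'))]
    simp [add_assoc]
  let q : (ι → ℝ) → UnitAddTorus ι := fun x i => (x i : UnitAddCircle)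
  have hq : IsOpenQuotientMap q := by
    have := IsOpenQuotientMap.piMap (f := fun (_ : ι) (x : ℝ) => (x : UnitAddCircle))
      (fun i => QuotientAddGroup.isOpenQuotientMap_mk)
    exact this
  have hlift : ∀ x y : ι → ℝ, q x = q y → Φ (B x) = Φ (B y) := by
    intro x y hxy
    have h1 : ∀ i, ∃ k : ℤ, x i = y i + k := by
      intro i
      have : (x i : UnitAddCircle) = (y i : UnitAddCircle) := congrFun hxy i
      obtain ⟨k, hk⟩ := (QuotientAddGroup.eq_iff_sub_mem.1 this)
      refine ⟨k, ?_⟩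
      simp at hk
      linarith
    choose k hk using h1
    have h2 : B x = B y + ((∑ i, k i • b i : L) : EuclideanSpace ℝ (Fin n)) := by
      have : x = y + fun i => (k i : ℝ) := by ext i; simp [hk]
      rw [this, map_add]
      congr 1
      simp [hB, Basis.equivFun_symm_apply, hbE]
      exact Finset.sum_congr rfl fun i _ => Int.cast_smul_eq_zsmul ℝ _ _
    rw [h2, hper]
  let F : C(UnitAddTorus ι, ℂ) :=
    ⟨fun t => Φ (B (Function.surjInv hq.surjective t)), by
      rw [hq.isQuotientMap.continuous_iff]
      have : (fun t => Φ (B (Function.surjInv hq.surjective t))) ∘ q = fun x => Φ (B x) := by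
        ext x
        exact hlift _ _ (Function.surjInv_eq hq.surjective _)
      rw [this]
      exact hΦ.comp B.continuous⟩
  have hF : ∀ x, F (q x) = Φ (B x) := fun x =>
    hlift _ _ (Function.surjInv_eq hq.surjective _)
  have hem : ∀ m, Continuous (e m) := by
    intro m
    simp only [he]
    fun_prop
  have hen : ∀ m v, ‖e m v‖ = 1 := by
    intro m v
    simp only [he]
    rw [show 2 * (Real.pi : ℂ) * Complex.I * (⟪v, D m⟫ : ℝ) =
      ((2 * Real.pi * ⟪v, D m⟫ : ℝ) : ℂ) * Complex.I by push_cast; ring]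
    exact Complex.norm_exp_ofReal_mul_I _
  have hcoeff : ∀ m, UnitAddTorus.mFourierCoeff F m = κ * 𝓕 f (D m) := by
    intro m
    rw [UnitAddTorus.mFourierCoeff_eq_integral F m 0]
    have hset : ({x : ι → ℝ | ∀ i, x i ∈ Set.Ioc ((0 : ι → ℝ) i) ((0 : ι → ℝ) i + 1)} : Set _)
        =ᵐ[volume] B ⁻¹' (ZSpan.fundamentalDomain bE) := by
      have h1 : ({x : ι → ℝ | ∀ i, x i ∈ Set.Ioc ((0 : ι → ℝ) i) ((0 : ι → ℝ) i + 1)} : Set _)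
        = Set.pi Set.univ fun i => Set.Ioc ((0 : ι → ℝ) i) ((1 : ι → ℝ) i) := by
        ext x; simp
      have h2 : B ⁻¹' (ZSpan.fundamentalDomain bE) =
          Set.pi Set.univ fun i => Set.Ico ((0 : ι → ℝ) i) ((1 : ι → ℝ) i) := by
        ext x; simp [ZSpan.mem_fundamentalDomain, hBr]
      rw [h1, h2]
      exact Measure.univ_pi_Ioc_ae_eq_Icc.trans Measure.univ_pi_Ico_ae_eq_Icc.symm
    rw [setIntegral_congr_set hset]
    have h3 : ∀ x : ι → ℝ, UnitAddTorus.mFourier (-m) (fun i => (x i : UnitAddCircle)) •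
        F (fun i => (x i : UnitAddCircle)) = (fun v => e (-m) v * Φ v) (B x) := by
      intro x
      rw [hmF, smul_eq_mul]
      exact congrArg _ (hF x)
    simp_rw [h3]
    rw [← hBe.setIntegral_map (μ := volume) (fun v => e (-m) v * Φ v)]
    rw [← hμ]
    have hg : Integrable (fun v => e (-m) v * f v) μ := by
      rw [hμv]
      apply Integrable.smul_measure_nnreal
      refine hfi.bdd_mul (c := 1) (hem _).aestronglyMeasurable ?_
      exact Filter.Eventually.of_forall fun v => (hen _ v).le
    have hfd := ZLattice.isAddFundamentalDomain b μ
    have : VAddInvariantMeasure L (EuclideanSpace ℝ (Fin n)) μ :=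
      inferInstanceAs <| VAddInvariantMeasure L.toAddSubgroup (EuclideanSpace ℝ (Fin n)) μ
    have h4 : ∫ v, e (-m) v * f v ∂μ =
        ∑' l : L, ∫ v in ZSpan.fundamentalDomain bE, e (-m) v * f (v + l) ∂μ := by
      rw [hfd.integral_eq_tsum'' _ hg]
      refine tsum_congr fun l => ?_
      congr 1
      ext v
      rw [Submodule.vadd_def, vadd_eq_add, add_comm, hadd]
    have h5 : ∫ v in ZSpan.fundamentalDomain bE, e (-m) v * Φ v ∂μ =
        ∑' l : L, ∫ v in ZSpan.fundamentalDomain bE, e (-m) v * f (v + l) ∂μ := by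
      simp only [hΦdef, ← tsum_mul_left]
      apply integral_tsum
      · intro l
        have h6 : Integrable (fun v => e (-m) (v + l) * f (v + l)) μ := hg.comp_add_right _
        simp only [hadd] at h6
        exact h6.aestronglyMeasurable.restrict
      · have h7 := hfd.lintegral_eq_tsum'' (fun v => ‖e (-m) v * f v‖ₑ)
        have h8 : ∑' l : L, ∫⁻ v in ZSpan.fundamentalDomain bE, ‖e (-m) v * f (v + l)‖ₑ ∂μ =
            ∫⁻ v, ‖e (-m) v * f v‖ₑ ∂μ := by
          rw [h7]
          refine tsum_congr fun l => ?_
          congr 1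
          ext v
          rw [Submodule.vadd_def, vadd_eq_add, add_comm (l : EuclideanSpace ℝ (Fin n)), hadd]
        rw [h8]
        exact hg.2.ne
    rw [h5, ← h4, hμv, integral_smul_nnreal_measure, Real.fourier_eq']
    rw [NNReal.smul_def, Complex.real_smul]
    congr 2
    ext v
    simp only [he, smul_eq_mul]
    congr 2
    have : D (-m) = - D m := by
      refine ext_inner_left ℝ fun v => ?_
      rw [inner_neg_right, hD, hD]
      simp
    rw [this, inner_neg_right]
    push_cast
    ring
  have hs : Summable (UnitAddTorus.mFourierCoeff F) := by
    rw [funext hcoeff]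
    exact hsum.mul_left _
  have key := UnitAddTorus.hasSum_mFourier_series_apply_of_summable hs (q (B.symm v))
  have h9 : F (q (B.symm v)) = Φ v := by rw [hF]; simp
  rw [h9] at key
  change Φ v = _
  rw [← key.tsum_eq, ← tsum_mul_left]
  refine tsum_congr fun m => ?_
  rw [hcoeff, smul_eq_mul, show q (B.symm v) = fun i => ((B.symm v i : ℝ) : UnitAddCircle) from rfl,
    hmF, mul_assoc]
  simp [he]

end Analysis

section Modular
open UpperHalfPlane ModularForm SlashInvariantForm ModularFormClass MatrixGroups Filter Asymptotics
open scoped Manifold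

theorem ucv_modular_zero (n : ℕ) (G : ℂ → ℂ) (hd : DifferentiableOn ℂ G {z | 0 < z.im})
    (hT : ∀ τ : ℂ, 0 < τ.im → G (τ + 1) = G τ)
    (hS : ∀ τ : ℂ, 0 < τ.im → G (-1 / τ) = τ ^ (12 * n) * G τ)
    (K : ℝ) (hK : ∀ τ : ℂ, 1 ≤ τ.im → ‖G τ‖ ≤ K * Real.exp (-2 * Real.pi * τ.im) ^ (n + 1)) :
    ∀ τ : ℂ, 0 < τ.im → G τ = 0 := by
  set f : ℍ → ℂ := fun z => G z / ModularForm.discriminant z ^ n with hf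
  have hΔT : ∀ z : ℍ, ModularForm.discriminant (ModularGroup.T • z) = ModularForm.discriminant z := by
    intro z
    have := congrFun discriminant_T_invariant z
    have hden : denom ModularGroup.T z = 1 := by
      rw [ModularGroup.denom_apply]; simp [ModularGroup.T]
    rw [SL_slash_apply, hden, one_zpow, mul_one] at this
    exact this
  have hΔS : ∀ z : ℍ, ModularForm.discriminant (ModularGroup.S • z) =
      (z : ℂ) ^ 12 * ModularForm.discriminant z := by
    intro z
    have := congrFun discriminant_S_invariant z
    rw [SL_slash_apply, ModularGroup.denom_S] at this
    rw [← this]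
    have := z.ne_zero
    rw [zpow_neg]
    field_simp
  have hfT : f ∣[(0 : ℤ)] ModularGroup.T = f := by
    ext z
    rw [SL_slash_apply]
    simp only [neg_zero, zpow_zero, mul_one, hf, hΔT]
    rw [modular_T_smul, coe_vadd]
    rw [add_comm]
    push_cast
    rw [hT _ z.im_pos]
  have hfS : f ∣[(0 : ℤ)] ModularGroup.S = f := by
    ext z
    rw [SL_slash_apply]
    simp only [neg_zero, zpow_zero, mul_one, hf, hΔS]
    have h0 := z.ne_zero
    rw [modular_S_smul]
    have : ((-(z : ℂ))⁻¹) = -1 / z := by field_simp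
    simp only [this]
    rw [hS _ z.im_pos, mul_pow, ← pow_mul, mul_div_mul_left]
    exact pow_ne_zero _ h0
  have hslash := slash_action_generators_SL2Z hfS hfT
  have hbig : f =O[atImInfty] fun τ : ℍ => Real.exp (-2 * Real.pi * τ.im) := by
    have h1 : (fun z : ℍ => G z) =O[atImInfty]
        fun τ : ℍ => Real.exp (-2 * Real.pi * τ.im) ^ (n + 1) := by
      refine IsBigO.of_bound K ?_
      have : ∀ᶠ τ : ℍ in atImInfty, 1 ≤ τ.im := by
        rw [Filter.Eventually, atImInfty_mem]
        exact ⟨1, fun z hz => hz⟩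
      filter_upwards [this] with τ hτ
      refine (hK τ hτ).trans (le_of_eq ?_)
      rw [Real.norm_of_nonneg (by positivity)]
      rfl
    have h2 := (exp_isBigO_discriminant.inv_rev (by
      refine Eventually.of_forall fun τ h => absurd h (Real.exp_pos _).ne')).pow n
    have h3 := h1.mul h2
    refine (h3.congr' ?_ ?_)
    · refine Eventually.of_forall fun τ => ?_
      simp [hf, div_eq_mul_inv]
    · refine Eventually.of_forall fun τ => ?_
      have := (Real.exp_pos (-2 * Real.pi * τ.im)).ne'
      simp only
      rw [pow_succ', mul_assoc, inv_pow, mul_inv_cancel₀ (pow_ne_zero _ this), mul_one]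
  have hexp : Tendsto (fun τ : ℍ => Real.exp (-2 * Real.pi * τ.im)) atImInfty (nhds 0) := by
    refine Real.tendsto_exp_atBot.comp ?_
    have : Tendsto (fun τ : ℍ => τ.im) atImInfty atTop := tendsto_comap
    exact this.const_mul_atTop_of_neg (by nlinarith [Real.pi_pos])
  have hzero : Tendsto f atImInfty (nhds 0) := hbig.trans_tendsto hexp
  let F : ModularForm 𝒮ℒ 0 :=
    { toFun := f
      slash_action_eq' := fun _ ⟨γ, hγ⟩ ↦ hγ ▸ hslash γ
      holo' := by
        have h1 : MDiff (fun z : ℍ => G z) := by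
          rw [UpperHalfPlane.mdifferentiable_iff]
          refine hd.congr fun z hz => ?_
          simp [ofComplex_apply_of_im_pos hz]
        exact h1.div (CuspForm.discriminant.holo'.pow n)
          (fun z => pow_ne_zero _ (discriminant_ne_zero z))
      bdd_at_cusps' {c} hc := by
        rw [Subgroup.IsArithmetic.isCusp_iff_isCusp_SL2Z] at hc
        rw [OnePoint.isBoundedAt_iff_forall_SL2Z hc]
        intro γ _
        rw [hslash γ, IsBoundedAtImInfty, BoundedAtFilter]
        exact hzero.isBigO_one ℝ }
  obtain ⟨c, hc⟩ := levelOne_weight_zero_const F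
  have hc' : f = Function.const _ c := hc
  have hc0 : c = 0 := by
    rw [hc'] at hzero
    exact tendsto_nhds_unique tendsto_const_nhds hzero
  intro τ hτ
  have := congrFun hc' ⟨τ, hτ⟩
  simp only [hf, hc0, Function.const] at this
  rw [div_eq_zero_iff] at this
  exact this.resolve_right (pow_ne_zero _ (discriminant_ne_zero _))

end Modular

section Theta
open MeasureTheory FourierTransform Module

variable {n : ℕ} {L : Submodule ℤ (EuclideanSpace ℝ (Fin n))}

/-- The vector representing the integral functional with values `m i` on the basis. -/
noncomputable def ucvD [DiscreteTopology L] [IsZLattice ℝ L] {ι : Type} [Fintype ι]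
    (b : Basis ι ℤ L) (m : ι → ℤ) : EuclideanSpace ℝ (Fin n) :=
  (InnerProductSpace.toDual ℝ (EuclideanSpace ℝ (Fin n))).symm
    (LinearMap.toContinuousLinearMap
      (∑ i, (m i : ℝ) • (b.ofZLatticeBasis ℝ L).coord i))

theorem ucvD_inner [DiscreteTopology L] [IsZLattice ℝ L] {ι : Type} [Fintype ι]
    (b : Basis ι ℤ L) (m : ι → ℤ) (v : EuclideanSpace ℝ (Fin n)) :
    ⟪v, ucvD b m⟫ = ∑ i, (m i : ℝ) * (b.ofZLatticeBasis ℝ L).repr v i := by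
  rw [real_inner_comm, ucvD, InnerProductSpace.toDual_symm_apply]
  simp

theorem ucvD_inner_basis [DiscreteTopology L] [IsZLattice ℝ L] {ι : Type} [Fintype ι]
    (b : Basis ι ℤ L) (m : ι → ℤ) (i : ι) :
    ⟪(b i : EuclideanSpace ℝ (Fin n)), ucvD b m⟫ = m i := by
  classical
  rw [ucvD_inner, ← b.ofZLatticeBasis_apply ℝ L i]
  simp [Finsupp.single_apply]

theorem ucvD_mem [DiscreteTopology L] [IsZLattice ℝ L] {ι : Type} [Fintype ι]
    (hU : ∀ v : EuclideanSpace ℝ (Fin n), v ∈ L ↔ ∀ y ∈ L, ∃ k : ℤ, ⟪v, y⟫ = (k : ℝ))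
    (b : Basis ι ℤ L) (m : ι → ℤ) : ucvD b m ∈ L := by
  rw [hU]
  intro y hy
  refine ⟨∑ i, m i * b.repr ⟨y, hy⟩ i, ?_⟩
  rw [real_inner_comm, ucvD_inner]
  push_cast
  refine Finset.sum_congr rfl fun i _ => ?_
  rw [← Basis.ofZLatticeBasis_repr_apply ℝ L b ⟨y, hy⟩ i]

theorem ucvD_bijective [DiscreteTopology L] [IsZLattice ℝ L] {ι : Type} [Fintype ι]
    (hU : ∀ v : EuclideanSpace ℝ (Fin n), v ∈ L ↔ ∀ y ∈ L, ∃ k : ℤ, ⟪v, y⟫ = (k : ℝ))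
    (b : Basis ι ℤ L) :
    Function.Bijective (fun m => (⟨ucvD b m, ucvD_mem hU b m⟩ : L)) := by
  constructor
  · intro m m' h
    have h' : ucvD b m = ucvD b m' := congrArg Subtype.val h
    ext i
    have := ucvD_inner_basis b m i
    rw [h', ucvD_inner_basis] at this
    exact_mod_cast this.symm
  · intro l
    have h1 : ∀ i, ∃ k : ℤ, ⟪(l : EuclideanSpace ℝ (Fin n)), (b i : EuclideanSpace ℝ (Fin n))⟫ = k :=
      fun i => (hU l).1 l.2 _ (b i).2
    choose m hm using h1
    refine ⟨m, Subtype.ext ?_⟩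
    refine InnerProductSpace.ext_inner_left_basis (𝕜 := ℝ) (b.ofZLatticeBasis ℝ L) fun i => ?_
    rw [b.ofZLatticeBasis_apply ℝ L, ucvD_inner_basis, ← hm, real_inner_comm]

theorem ucv_exists_char [DiscreteTopology L] [IsZLattice ℝ L]
    (hU : ∀ v : EuclideanSpace ℝ (Fin n), v ∈ L ↔ ∀ y ∈ L, ∃ k : ℤ, ⟪v, y⟫ = (k : ℝ)) :
    ∃ w, IsCharacteristic n L w := by
  have : Module.Finite ℤ L := ZLattice.module_finite ℝ L
  have : Module.Free ℤ L := ZLattice.module_free ℝ L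
  let b := Module.finBasis ℤ L
  have h1 : ∀ i, ∃ k : ℤ, ⟪(b i : EuclideanSpace ℝ (Fin n)), (b i : EuclideanSpace ℝ (Fin n))⟫ = k :=
      fun i => (hU _).1 (b i).2 _ (b i).2
  choose m hm using h1
  have hwL := ucvD_mem hU b m
  refine ⟨ucvD b m, hwL, ?_⟩
  set w := ucvD b m with hw
  intro x hx
  rw [← b.ofZLatticeBasis_span ℝ L] at hx
  have key : x ∈ L ∧ ∃ k : ℤ, ⟪w, x⟫ - ⟪x, x⟫ = 2 * (k : ℝ) := by
    induction hx using Submodule.span_induction with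
    | mem x hx =>
      obtain ⟨i, rfl⟩ := hx
      rw [b.ofZLatticeBasis_apply ℝ L]
      refine ⟨(b i).2, 0, ?_⟩
      rw [real_inner_comm, hw, ucvD_inner_basis, hm]
      simp
    | zero => exact ⟨L.zero_mem, 0, by simp⟩
    | add x y _ _ hx hy =>
      obtain ⟨hxL, j, hj⟩ := hx
      obtain ⟨hyL, k, hk⟩ := hy
      obtain ⟨p, hp⟩ := (hU x).1 hxL y hyL
      refine ⟨L.add_mem hxL hyL, j + k - p, ?_⟩
      rw [inner_add_right, real_inner_add_add_self, hp]
      push_cast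
      linarith
    | smul a x _ hx =>
      obtain ⟨hxL, j, hj⟩ := hx
      obtain ⟨p, hp⟩ := (hU x).1 hxL x hxL
      refine ⟨L.smul_mem a hxL, ?_⟩
      obtain ⟨q, hq⟩ : ∃ q : ℤ, a - a * a = 2 * q := by
        rcases Int.even_or_odd a with ⟨c, hc⟩ | ⟨c, hc⟩
        · exact ⟨c - 2 * c * c, by rw [hc]; ring⟩
        · exact ⟨-2 * c * c - c, by rw [hc]; ring⟩
      refine ⟨a * j + q * p, ?_⟩
      rw [← Int.cast_smul_eq_zsmul ℝ, inner_smul_right, inner_smul_right, inner_smul_left]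
      have hq' : (a : ℝ) - a * a = 2 * q := by exact_mod_cast hq
      have hwx : ⟪w, x⟫ = p + 2 * j := by linarith
      rw [hwx, hp]
      push_cast
      simp only [conj_trivial]
      linear_combination (p : ℝ) * hq'
  exact key.2

/-- Theta series of the coset `h + L`. -/
noncomputable def ucvTheta (L : Submodule ℤ (EuclideanSpace ℝ (Fin n)))
    (h : EuclideanSpace ℝ (Fin n)) (τ : ℂ) : ℂ :=
  ∑' l : L, Complex.exp (-(Real.pi * (-Complex.I * τ)) *
    ‖h + (l : EuclideanSpace ℝ (Fin n))‖ ^ 2)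

theorem ucv_re (τ : ℂ) : ((Real.pi : ℂ) * (-Complex.I * τ)).re = Real.pi * τ.im := by
  simp

theorem ucv_fe [DiscreteTopology L] [IsZLattice ℝ L]
    (hU : ∀ v : EuclideanSpace ℝ (Fin n), v ∈ L ↔ ∀ y ∈ L, ∃ k : ℤ, ⟪v, y⟫ = (k : ℝ)) :
    ∃ κ : ℝ, 0 ≤ κ ∧ ∀ (h : EuclideanSpace ℝ (Fin n)) (τ : ℂ), 0 < τ.im →
      ucvTheta L h τ = κ * ((1 / (-Complex.I * τ)) ^ ((n : ℂ) / 2) *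
        ∑' l : L, Complex.exp (-(Real.pi * (-Complex.I * (-1 / τ))) *
          ‖(l : EuclideanSpace ℝ (Fin n))‖ ^ 2) *
          Complex.exp (2 * Real.pi * Complex.I * ⟪h, (l : EuclideanSpace ℝ (Fin n))⟫)) := by
  have : Module.Finite ℤ L := ZLattice.module_finite ℝ L
  have : Module.Free ℤ L := ZLattice.module_free ℝ L
  obtain ⟨b⟩ : Nonempty (Basis (Fin (Module.finrank ℤ L)) ℤ L) := ⟨Module.finBasis ℤ L⟩
  obtain ⟨κ, hκ0, hκ⟩ := ucv_poisson b (ucvD b) (ucvD_inner b)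
  refine ⟨κ, hκ0, ?_⟩
  intro h τ hτ
  have hτ0 : τ ≠ 0 := by rintro rfl; simp at hτ
  set c : ℂ := Real.pi * (-Complex.I * τ) with hc
  have hcre : 0 < c.re := by rw [hc, ucv_re]; positivity
  have hpi : (Real.pi : ℂ) ≠ 0 := by exact_mod_cast Real.pi_ne_zero
  set f : EuclideanSpace ℝ (Fin n) → ℂ := fun v => Complex.exp (-c * ‖v‖ ^ 2) with hf
  have hF : ∀ w, 𝓕 f w = (1 / (-Complex.I * τ)) ^ ((n : ℂ) / 2) *
      Complex.exp (-(Real.pi * (-Complex.I * (-1 / τ))) * ‖w‖ ^ 2) := by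
    intro w
    rw [hf, fourier_gaussian_innerProductSpace hcre w, finrank_euclideanSpace_fin]
    congr 2
    · rw [hc]; field_simp
    · rw [hc]; field_simp; simp
  have hfi : Integrable f := by
    have := GaussianFourier.integrable_cexp_neg_mul_sq_norm_add hcre 0
      (0 : EuclideanSpace ℝ (Fin n))
    simpa [hf] using this
  obtain ⟨eqv, heqv⟩ : ∃ e : (Fin (Module.finrank ℤ L) → ℤ) ≃ L,
      ∀ m, (e m : EuclideanSpace ℝ (Fin n)) = ucvD b m :=
    ⟨Equiv.ofBijective _ (ucvD_bijective hU b), fun _ => rfl⟩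
  have hcre' : 0 < ((Real.pi : ℂ) * (-Complex.I * (-1 / τ))).re := by
    rw [ucv_re, neg_div, one_div, Complex.neg_im, Complex.inv_im]
    have : 0 < Complex.normSq τ := Complex.normSq_pos.2 hτ0
    have h2 : 0 < -(-τ.im / Complex.normSq τ) := by rw [neg_div, neg_neg]; positivity
    positivity
  have hsum : Summable fun l : L => 𝓕 f (l : EuclideanSpace ℝ (Fin n)) := by
    simp_rw [hF]
    refine Summable.mul_left _ (Summable.of_norm ?_)
    simp_rw [ucv_norm_cexp]
    exact ucv_summable_zero hcre'
  have hsum2 : Summable fun m => 𝓕 f (ucvD b m) := by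
    have h1 := (eqv.summable_iff).2 hsum
    refine h1.congr fun m => ?_
    rw [Function.comp_apply, heqv]
  have := hκ f hfi (ucv_continuous_tsum hcre) hsum2 h
  rw [ucvTheta]
  refine this.trans ?_
  congr 1
  rw [← tsum_mul_left, ← eqv.tsum_eq]
  refine tsum_congr fun m => ?_
  rw [hF, mul_assoc, heqv]

theorem ucv_summable_theta [DiscreteTopology L] [IsZLattice ℝ L] (h : EuclideanSpace ℝ (Fin n))
    {τ : ℂ} (hτ : 0 < τ.im) : Summable fun l : L => Complex.exp (-(Real.pi * (-Complex.I * τ)) *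
    ‖h + (l : EuclideanSpace ℝ (Fin n))‖ ^ 2) := by
  refine Summable.of_norm ?_
  simp_rw [ucv_norm_cexp, ucv_re]
  exact ucv_summable (by positivity) h

theorem ucv_differentiableOn [DiscreteTopology L] [IsZLattice ℝ L]
    (h : EuclideanSpace ℝ (Fin n)) : DifferentiableOn ℂ (ucvTheta L h) {z | 0 < z.im} := by
  intro τ₀ hτ₀
  have hτ₀' : 0 < τ₀.im := hτ₀
  have ho : IsOpen {z : ℂ | τ₀.im / 2 < z.im} := isOpen_lt continuous_const Complex.continuous_im
  have : DifferentiableOn ℂ (ucvTheta L h) {z : ℂ | τ₀.im / 2 < z.im} := by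
    refine Complex.differentiableOn_tsum_of_summable_norm
      (ucv_summable (L := L) (a := Real.pi * (τ₀.im / 2)) (by positivity) h) ?_ ho ?_
    · intro l
      fun_prop
    · intro l τ hτ
      have hτ' : τ₀.im / 2 < τ.im := hτ
      rw [ucv_norm_cexp, ucv_re]
      gcongr
  exact (this.differentiableAt (ho.mem_nhds (by simp; linarith))).differentiableWithinAt

theorem ucv_bound [DiscreteTopology L] [IsZLattice ℝ L]
    (h : EuclideanSpace ℝ (Fin n)) (r : ℝ)
    (hr : ∀ l : L, r ≤ ‖h + (l : EuclideanSpace ℝ (Fin n))‖ ^ 2) :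
    ∃ K : ℝ, 0 ≤ K ∧ ∀ τ : ℂ, 1 ≤ τ.im → ‖ucvTheta L h τ‖ ≤ K * Real.exp (-Real.pi * r * τ.im) := by
  have hs := ucv_summable (L := L) Real.pi_pos h
  refine ⟨Real.exp (Real.pi * r) * ∑' l : L, Real.exp (-Real.pi *
    ‖h + (l : EuclideanSpace ℝ (Fin n))‖ ^ 2),
    mul_nonneg (Real.exp_pos _).le (tsum_nonneg fun _ => (Real.exp_pos _).le), ?_⟩
  intro τ hτ
  have hle : ∀ l : L, ‖Complex.exp (-(Real.pi * (-Complex.I * τ)) *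
    ‖h + (l : EuclideanSpace ℝ (Fin n))‖ ^ 2)‖ ≤
      (Real.exp (Real.pi * r) * Real.exp (-Real.pi * r * τ.im)) *
      Real.exp (-Real.pi * ‖h + (l : EuclideanSpace ℝ (Fin n))‖ ^ 2) := by
    intro l
    rw [ucv_norm_cexp, ucv_re, ← Real.exp_add, ← Real.exp_add]
    apply Real.exp_le_exp.2
    have := hr l
    have h1 : 0 ≤ Real.pi * ((τ.im - 1) * (‖h + (l : EuclideanSpace ℝ (Fin n))‖ ^ 2 - r)) :=
      mul_nonneg Real.pi_pos.le (mul_nonneg (by linarith) (by linarith))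
    nlinarith
  refine (tsum_of_norm_bounded (hs.mul_left _).hasSum hle).trans (le_of_eq ?_)
  rw [tsum_mul_left]
  ring

theorem ucv_theta_I_ne [DiscreteTopology L] [IsZLattice ℝ L]
    (h : EuclideanSpace ℝ (Fin n)) : ucvTheta L h Complex.I ≠ 0 := by
  have hs := ucv_summable (L := L) Real.pi_pos h
  have : ucvTheta L h Complex.I = ((∑' l : L, Real.exp (-Real.pi *
    ‖h + (l : EuclideanSpace ℝ (Fin n))‖ ^ 2) : ℝ) : ℂ) := by
    rw [ucvTheta, Complex.ofReal_tsum]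
    refine tsum_congr fun l => ?_
    push_cast
    simp
  rw [this]
  exact_mod_cast (hs.tsum_pos (fun _ => (Real.exp_pos _).le) 0 (Real.exp_pos _)).ne'

end Theta

/-- Every unimodular lattice in `ℝⁿ` has a characteristic vector of norm at most `n`. -/
theorem exists_characteristic_norm_le (n : ℕ)
    (L : Submodule ℤ (EuclideanSpace ℝ (Fin n))) (hL : IsUnimodularLattice n L) :
    ∃ w : EuclideanSpace ℝ (Fin n), IsCharacteristic n L w ∧ ⟪w, w⟫ ≤ (n : ℝ) := by
  obtain ⟨hdisc, hspan, hU⟩ := hL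
  have : IsZLattice ℝ L := ⟨hspan⟩
  by_contra hcon
  push Not at hcon
  obtain ⟨w, hw⟩ := ucv_exists_char hU
  obtain ⟨hwL, hwc⟩ := hw
  obtain ⟨N, hN⟩ := (hU w).1 hwL w hwL
  set h : EuclideanSpace ℝ (Fin n) := (2⁻¹ : ℝ) • w with hh
  -- norms in the coset
  have hcoset : ∀ l : L, ∃ k : ℤ, 4 * ‖h + (l : EuclideanSpace ℝ (Fin n))‖ ^ 2 = N + 8 * k := by
    intro l
    obtain ⟨k, hk⟩ := hwc l l.2
    obtain ⟨p, hp⟩ := (hU l).1 l.2 l l.2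
    refine ⟨p + k, ?_⟩
    rw [← real_inner_self_eq_norm_sq, real_inner_add_add_self, hh, inner_smul_left,
      inner_smul_left, inner_smul_right, hN, hp]
    simp only [conj_trivial]
    push_cast
    linarith
  have hge : ∀ l : L, ((n : ℝ) + 1) / 4 ≤ ‖h + (l : EuclideanSpace ℝ (Fin n))‖ ^ 2 := by
    intro l
    set x : EuclideanSpace ℝ (Fin n) := w + (2 : ℤ) • (l : EuclideanSpace ℝ (Fin n)) with hx
    have hx2 : x = (2 : ℝ) • (h + (l : EuclideanSpace ℝ (Fin n))) := by
      rw [hx, hh, smul_add, smul_smul, ← Int.cast_smul_eq_zsmul ℝ]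
      norm_num
    have hxc : IsCharacteristic n L x := by
      refine ⟨L.add_mem hwL (L.smul_mem _ l.2), fun y hy => ?_⟩
      obtain ⟨k, hk⟩ := hwc y hy
      obtain ⟨p, hp⟩ := (hU l).1 l.2 y hy
      refine ⟨k + p, ?_⟩
      rw [hx, inner_add_left, ← Int.cast_smul_eq_zsmul ℝ, inner_smul_left, hp]
      push_cast
      simp only [map_ofNat]
      linarith
    have h1 := hcon x hxc
    have h2 : ⟪x, x⟫ = 4 * ‖h + (l : EuclideanSpace ℝ (Fin n))‖ ^ 2 := by
      rw [hx2, real_inner_self_eq_norm_sq, norm_smul]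
      norm_num
      ring
    obtain ⟨k, hk⟩ := hcoset l
    rw [h2, hk] at h1
    have h3 : (n : ℤ) + 1 ≤ N + 8 * k := by
      have : (n : ℤ) < N + 8 * k := by exact_mod_cast h1
      omega
    have h4 : (n : ℝ) + 1 ≤ N + 8 * k := by exact_mod_cast h3
    linarith
  obtain ⟨κ, hκ0, hfe⟩ := ucv_fe hU
  set A := ucvTheta L 0 with hA
  set C := ucvTheta L h with hC
  set s : ℂ → ℂ := fun τ => κ * (1 / (-Complex.I * τ)) ^ ((n : ℂ) / 2) with hs
  have hinv : ∀ τ : ℂ, 0 < τ.im → 0 < (-1 / τ).im := by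
    intro τ hτ
    have hτ0 : τ ≠ 0 := by rintro rfl; simp at hτ
    rw [neg_div, one_div, Complex.neg_im, Complex.inv_im]
    have : 0 < Complex.normSq τ := Complex.normSq_pos.2 hτ0
    rw [neg_div, neg_neg]
    positivity
  have hinv2 : ∀ τ : ℂ, 0 < τ.im → -1 / (-1 / τ) = τ := by
    intro τ hτ
    have hτ0 : τ ≠ 0 := by rintro rfl; simp at hτ
    field_simp
  have hA1 : ∀ τ : ℂ, 0 < τ.im → A τ = s τ * A (-1 / τ) := by
    intro τ hτ
    rw [hA, hfe 0 τ hτ, hs]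
    simp only [ucvTheta, inner_zero_left, Complex.ofReal_zero, mul_zero, Complex.exp_zero, mul_one,
      zero_add, mul_assoc]
  have hC1 : ∀ τ : ℂ, 0 < τ.im → C τ = s τ * A (-1 / τ + 1) := by
    intro τ hτ
    rw [hA, hC, hfe h τ hτ, hs]
    simp only [ucvTheta, zero_add, mul_assoc]
    congr 2
    refine tsum_congr fun l => ?_
    rw [← Complex.exp_add, Complex.exp_eq_exp_iff_exists_int]
    obtain ⟨k, hk⟩ := hwc l l.2
    refine ⟨k, ?_⟩
    rw [real_inner_self_eq_norm_sq] at hk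
    have hk' : ⟪w, (l : EuclideanSpace ℝ (Fin n))⟫ =
      ‖(l : EuclideanSpace ℝ (Fin n))‖ ^ 2 + 2 * k := by linarith
    rw [hh, inner_smul_left, hk']
    push_cast
    simp
    ring
  -- periodicity
  have hA2 : ∀ τ : ℂ, A (τ + 1 + 1) = A τ := by
    intro τ
    simp only [hA, ucvTheta]
    refine tsum_congr fun l => ?_
    obtain ⟨p, hp⟩ := (hU l).1 l.2 l l.2
    rw [real_inner_self_eq_norm_sq] at hp
    rw [Complex.exp_eq_exp_iff_exists_int]
    refine ⟨p, ?_⟩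
    rw [zero_add, ← Complex.ofReal_pow, hp]
    push_cast
    ring
  have hC2 : ∀ τ : ℂ, C (τ + 1) = Complex.exp (Real.pi * Complex.I * N / 4) * C τ := by
    intro τ
    simp only [hC, ucvTheta]
    rw [← tsum_mul_left]
    refine tsum_congr fun l => ?_
    obtain ⟨k, hk⟩ := hcoset l
    rw [← Complex.exp_add, Complex.exp_eq_exp_iff_exists_int]
    refine ⟨k, ?_⟩
    have hk' : ‖h + (l : EuclideanSpace ℝ (Fin n))‖ ^ 2 = N / 4 + 2 * k := by linarith
    rw [← Complex.ofReal_pow, hk']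
    push_cast
    ring
  have hexp8 : Complex.exp (Real.pi * Complex.I * N / 4) ^ 8 = 1 := by
    rw [← Complex.exp_nat_mul, Complex.exp_eq_one_iff]
    exact ⟨N, by push_cast; ring⟩
  -- the constant
  have hI : (-1 / Complex.I : ℂ) = Complex.I := by
    rw [div_eq_iff Complex.I_ne_zero, Complex.I_mul_I]
  have hκ1 : κ = 1 := by
    have h1 := hA1 Complex.I (by simp)
    rw [hI] at h1
    have h2 : s Complex.I = κ := by simp [hs]
    rw [h2] at h1
    have h3 := ucv_theta_I_ne (L := L) 0
    have : (κ : ℂ) = 1 := by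
      apply mul_right_cancel₀ h3
      rw [one_mul]
      exact h1.symm
    exact_mod_cast this
  have hs8 : ∀ τ : ℂ, 0 < τ.im → s τ ^ 8 * τ ^ (4 * n) = 1 := by
    intro τ hτ
    have hτ0 : τ ≠ 0 := by rintro rfl; simp at hτ
    simp only [hs, hκ1]
    rw [Complex.ofReal_one, one_mul, ← Complex.cpow_nat_mul,
      show ((8 : ℕ) : ℂ) * ((n : ℂ) / 2) = ((4 * n : ℕ) : ℂ) by push_cast; ring,
      Complex.cpow_natCast, ← mul_pow, pow_mul]
    have : (1 / (-Complex.I * τ) * τ) ^ 4 = 1 := by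
      have : 1 / (-Complex.I * τ) * τ = Complex.I := by
        field_simp
        simp
      rw [this, Complex.I_pow_four]
    rw [this, one_pow]
  clear_value s
  set G : ℂ → ℂ := fun τ => (A τ * A (τ + 1) * C τ) ^ 8 with hG
  have hadd1 : ∀ τ : ℂ, (τ + 1).im = τ.im := by intro τ; simp
  obtain ⟨KA, hKA0, hKA⟩ := ucv_bound (L := L) 0 0 (fun l => by positivity)
  obtain ⟨KC, hKC0, hKC⟩ := ucv_bound (L := L) h _ hge
  have hzero := ucv_modular_zero n G ?_ ?_ ?_ ((KA * KA * KC) ^ 8) ?_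
  · -- nonvanishing at I
    have h0 := hzero Complex.I (by simp)
    rw [hG] at h0
    have h1 := eq_zero_of_pow_eq_zero h0
    have hAI : A Complex.I ≠ 0 := ucv_theta_I_ne 0
    have hCI : C Complex.I ≠ 0 := ucv_theta_I_ne h
    have hAI1 : A (Complex.I + 1) ≠ 0 := by
      intro h2
      apply hCI
      rw [hC1 _ (by simp), hI, h2, mul_zero]
    exact (mul_ne_zero (mul_ne_zero hAI hAI1) hCI) h1
  · have hdA := ucv_differentiableOn (L := L) 0
    have hdC := ucv_differentiableOn (L := L) h
    have hdA1 : DifferentiableOn ℂ (fun τ => A (τ + 1)) {z | 0 < z.im} :=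
      hdA.comp (by fun_prop) (fun z hz => by simpa using hz)
    exact ((hdA.mul hdA1).mul hdC).pow 8
  · intro τ _
    simp only [hG]
    rw [hA2, hC2]
    calc (A (τ + 1) * A τ * (Complex.exp (Real.pi * Complex.I * N / 4) * C τ)) ^ 8
        = Complex.exp (Real.pi * Complex.I * N / 4) ^ 8 * (A τ * A (τ + 1) * C τ) ^ 8 := by ring
      _ = _ := by rw [hexp8, one_mul]
  · intro τ hτ
    have hτ0 : τ ≠ 0 := by rintro rfl; simp at hτ
    have e1 := hA1 τ hτ
    have e2 := hC1 τ hτ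
    have e3 := hC1 (-1 / τ) (hinv τ hτ)
    rw [hinv2 τ hτ] at e3
    have e4 := hs8 τ hτ
    have e5 := hs8 (-1 / τ) (hinv τ hτ)
    have e6 : (-1 / τ) ^ (4 * n) * τ ^ (4 * n) = 1 := by
      rw [← mul_pow, div_mul_cancel₀ _ hτ0, pow_mul]
      norm_num
    have e7 : s (-1 / τ) ^ 8 = τ ^ (4 * n) := by
      calc s (-1 / τ) ^ 8 = s (-1 / τ) ^ 8 * ((-1 / τ) ^ (4 * n) * τ ^ (4 * n)) := by
            rw [e6, mul_one]
        _ = (s (-1 / τ) ^ 8 * (-1 / τ) ^ (4 * n)) * τ ^ (4 * n) := by ring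
        _ = _ := by rw [e5, one_mul]
    simp only [hG]
    rw [e3, e1, e2]
    simp only [mul_pow]
    rw [e7]
    have e8 : τ ^ (12 * n) = τ ^ (4 * n) * τ ^ (4 * n) * τ ^ (4 * n) := by
      rw [← pow_add, ← pow_add]; congr 1; ring
    rw [e8]
    linear_combination (- (A (-1 / τ) ^ 8 * A (-1 / τ + 1) ^ 8 * A (τ + 1) ^ 8 * τ ^ (4 * n)) *
      (1 + s τ ^ 8 * τ ^ (4 * n))) * e4
  · intro τ hτ
    have b1 := hKA τ hτ
    have b2 := hKA (τ + 1) (by rw [hadd1]; exact hτ)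
    have b3 := hKC τ hτ
    simp only [mul_zero, zero_mul, Real.exp_zero, mul_one] at b1 b2
    simp only [hG]
    rw [norm_pow, norm_mul, norm_mul]
    have b4 : ‖A τ‖ * ‖A (τ + 1)‖ * ‖C τ‖ ≤
        KA * KA * (KC * Real.exp (-Real.pi * (((n : ℝ) + 1) / 4) * τ.im)) := by
      gcongr
    refine (pow_le_pow_left₀ (by positivity) b4 8).trans (le_of_eq ?_)
    rw [← mul_assoc, mul_pow, ← Real.exp_nat_mul, ← Real.exp_nat_mul]
    congr 2
    push_cast
    ring
end

section
/- Let L be a unimodular lattice in ℝ^n such that every characteristic vector w of L has norm ⟪w,w⟫ ≥ n. Then L is isometric to the standard lattice ℤ^n: there exists an orthonormal basis e₁, …, e_n of ℝ^n such that L equals the ℤ-span of {e₁, …, e_n}. -/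
open scoped RealInnerProductSpace

lemma summable_gauss0 {n : ℕ} (L : Submodule ℤ (EuclideanSpace ℝ (Fin n))) [DiscreteTopology L]
    {c : ℝ} (hc : 0 < c) : Summable fun v : L => Real.exp (-c * ‖(v : EuclideanSpace ℝ (Fin n))‖ ^ 2) := by
  set N := Module.finrank ℤ L + 1
  have h1 := ZLattice.summable_norm_pow_inv L (2 * N) (by omega)
  refine Summable.of_norm_bounded_eventually (h1.mul_left (N.factorial / c ^ N)) ?_
  have : ∀ᶠ v : L in Filter.cofinite, v ≠ 0 := by
    simp
  filter_upwards [this] with v hv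
  have hv' : 0 < ‖v‖ := norm_pos_iff.mpr hv
  rw [Real.norm_of_nonneg (Real.exp_pos _).le, neg_mul, Real.exp_neg]
  have h2 := Real.pow_div_factorial_le_exp (c * ‖v‖ ^ 2) (by positivity) N
  have h3 : (0:ℝ) < (c * ‖v‖ ^ 2) ^ N / N.factorial := by positivity
  calc (Real.exp (c * ‖v‖ ^ 2))⁻¹ ≤ ((c * ‖v‖ ^ 2) ^ N / N.factorial)⁻¹ := by
        gcongr
    _ = _ := by
        rw [mul_pow, ← pow_mul, inv_pow]
        field_simp

lemma gauss_bound {E : Type*} [NormedAddCommGroup E] [InnerProductSpace ℝ E] (u v : E) :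
    ‖v‖ ^ 2 / 2 - ‖u‖ ^ 2 ≤ ‖v + u‖ ^ 2 := by
  have h : ‖v‖ ≤ ‖v + u‖ + ‖u‖ := by
    simpa using norm_sub_le (v + u) u
  nlinarith [norm_nonneg v, norm_nonneg u, norm_nonneg (v + u), sq_nonneg (‖v + u‖ - ‖u‖)]

lemma gauss_exp_bound {E : Type*} [NormedAddCommGroup E] [InnerProductSpace ℝ E] {c : ℝ} (hc : 0 ≤ c) (u v : E) :
    Real.exp (-c * ‖v + u‖ ^ 2) ≤ Real.exp (c * ‖u‖ ^ 2) * Real.exp (-(c / 2) * ‖v‖ ^ 2) := by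
  rw [← Real.exp_add]
  apply Real.exp_le_exp.mpr
  nlinarith [gauss_bound u v]

lemma summable_gauss {n : ℕ} (L : Submodule ℤ (EuclideanSpace ℝ (Fin n))) [DiscreteTopology L]
    {c : ℝ} (hc : 0 < c) (u : EuclideanSpace ℝ (Fin n)) :
    Summable fun v : L => Real.exp (-c * ‖(v : EuclideanSpace ℝ (Fin n)) + u‖ ^ 2) := by
  refine Summable.of_nonneg_of_le (fun _ => (Real.exp_pos _).le) (fun v => gauss_exp_bound hc.le u (v : EuclideanSpace ℝ (Fin n)))
    ((summable_gauss0 L (half_pos hc)).mul_left _)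
section
open MeasureTheory Filter Topology

lemma box_hasSum {n : ℕ} {G : Type*} [NormedAddCommGroup G] [NormedSpace ℝ G]
    (h : (Fin n → ℝ) → G) (hi : Integrable h) :
    HasSum (fun m : Fin n → ℤ => ∫ x in {x : Fin n → ℝ | ∀ i, x i ∈ Set.Ioc (0:ℝ) (0 + 1)},
      h (x + fun i => (m i : ℝ))) (∫ x, h x) := by
  let s : (Fin n → ℤ) → Set (Fin n → ℝ) := fun m => {x | ∀ i, x i ∈ Set.Ioc (m i : ℝ) (m i + 1)}
  have hs : ∀ m, MeasurableSet (s m) := fun m => by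
    have : s m = Set.pi Set.univ (fun i => Set.Ioc (m i : ℝ) (m i + 1)) := by
      ext x; simp [s, Set.mem_pi]
    rw [this]
    exact MeasurableSet.univ_pi fun i => measurableSet_Ioc
  have hdisj : Pairwise (Function.onFun Disjoint s) := by
    intro m m' hmm
    rw [Function.onFun, Set.disjoint_left]
    intro x hx hx'
    apply hmm
    funext i
    have h1 := hx i
    have h2 := hx' i
    have e1 : ⌈x i⌉ = m i + 1 := by
      rw [Int.ceil_eq_iff]; push_cast; exact ⟨by linarith [h1.1], h1.2⟩
    have e2 : ⌈x i⌉ = m' i + 1 := by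
      rw [Int.ceil_eq_iff]; push_cast; exact ⟨by linarith [h2.1], h2.2⟩
    omega
  have hU : (⋃ m, s m) = Set.univ := by
    rw [Set.eq_univ_iff_forall]
    intro x
    rw [Set.mem_iUnion]
    refine ⟨fun i => ⌈x i⌉ - 1, fun i => ⟨?_, ?_⟩⟩
    · push_cast; linarith [Int.ceil_lt_add_one (x i)]
    · push_cast; linarith [Int.le_ceil (x i)]
  have key := hasSum_integral_iUnion (f := h) (μ := volume) hs hdisj (by rw [hU]; exact hi.integrableOn)
  rw [hU, setIntegral_univ] at key
  convert key using 2 with m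
  have hmp : MeasurePreserving (fun x : Fin n → ℝ => x + fun i => (m i : ℝ)) volume volume :=
    measurePreserving_add_right _ _
  have := hmp.setIntegral_preimage_emb (MeasurableEquiv.addRight _).measurableEmbedding h (s m)
  rw [← this]
  congr 2
  ext x
  simp only [s, Set.mem_preimage, Set.mem_ofPred_eq, Pi.add_apply, Set.mem_Ioc]
  refine forall_congr' fun i => ?_
  constructor
  · rintro ⟨h1, h2⟩; constructor <;> linarith
  · rintro ⟨h1, h2⟩; constructor <;> linarith

lemma mFourier_coe_aux {n : ℕ} (k : Fin n → ℤ) (x : Fin n → ℝ) :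
    UnitAddTorus.mFourier k (fun i => (x i : UnitAddCircle)) =
      Complex.exp (2 * Real.pi * Complex.I * ∑ i, (k i : ℂ) * (x i : ℂ)) := by
  simp only [UnitAddTorus.mFourier, ContinuousMap.coe_mk, fourier_coe_apply]
  rw [← Complex.exp_sum, Finset.mul_sum]
  congr 1
  refine Finset.sum_congr rfl fun i _ => ?_
  simp; ring

lemma poisson_pi {n : ℕ} (g : (Fin n → ℝ) → ℂ) (hg : Continuous g) (hi : Integrable g)
    (hb : ∀ R : ℝ, ∃ u : (Fin n → ℤ) → ℝ, Summable u ∧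
      ∀ m, ∀ x ∈ Metric.ball (0 : Fin n → ℝ) R, ‖g (x + fun i => (m i : ℝ))‖ ≤ u m)
    (hsum : Summable fun k : Fin n → ℤ =>
      ∫ y : Fin n → ℝ, Complex.exp (2 * Real.pi * Complex.I * ∑ i, ((-k) i : ℂ) * (y i : ℂ)) * g y)
    (x : Fin n → ℝ) :
    ∑' m : Fin n → ℤ, g (x + fun i => (m i : ℝ)) =
      ∑' k : Fin n → ℤ, (∫ y : Fin n → ℝ,
        Complex.exp (2 * Real.pi * Complex.I * ∑ i, ((-k) i : ℂ) * (y i : ℂ)) * g y) *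
        Complex.exp (2 * Real.pi * Complex.I * ∑ i, (k i : ℂ) * (x i : ℂ)) := by
  let F : (Fin n → ℝ) → ℂ := fun x => ∑' m : Fin n → ℤ, g (x + fun i => (m i : ℝ))
  have hFc : Continuous F := by
    rw [continuous_iff_continuousAt]
    intro x
    obtain ⟨u, hu, hub⟩ := hb (‖x‖ + 1)
    have : ContinuousOn F (Metric.ball 0 (‖x‖ + 1)) := by
      refine continuousOn_tsum (fun m => ?_) hu hub
      fun_prop
    refine this.continuousAt (Metric.isOpen_ball.mem_nhds ?_)
    simp
  have hFsum : ∀ x, Summable fun m : Fin n → ℤ => g (x + fun i => (m i : ℝ)) := by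
    intro x
    obtain ⟨u, hu, hub⟩ := hb (‖x‖ + 1)
    exact Summable.of_norm_bounded hu (fun m => hub m x (by simp))
  have hFp : ∀ (x y : Fin n → ℝ), (∀ i, (x i : UnitAddCircle) = (y i : UnitAddCircle)) → F x = F y := by
    intro x y hxy
    have : ∀ i, ∃ k : ℤ, y i = x i + k := by
      intro i
      have h0 : ((y i - x i : ℝ) : UnitAddCircle) = 0 := by
        rw [AddCircle.coe_sub, hxy i, sub_self]
      obtain ⟨k, hk⟩ := (AddCircle.coe_eq_zero_iff (1 : ℝ)).mp h0
      refine ⟨k, ?_⟩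
      simp at hk
      linarith
    choose k hk using this
    simp only [F]
    rw [← (Equiv.addLeft k).tsum_eq (fun m : Fin n → ℤ => g (x + fun i => (m i : ℝ)))]
    congr 1
    ext m
    congr 1
    ext i
    simp [hk]; ring
  let π₀ : (Fin n → ℝ) → UnitAddTorus (Fin n) := fun x i => (x i : UnitAddCircle)
  have hq : IsOpenQuotientMap π₀ :=
    IsOpenQuotientMap.piMap (fun i => QuotientAddGroup.isOpenQuotientMap_mk)
  have hr : Function.RightInverse (Function.surjInv hq.surjective) π₀ := Function.rightInverse_surjInv _
  have hFl : ∀ x, F (Function.surjInv hq.surjective (π₀ x)) = F x := fun x =>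
    hFp _ _ (fun i => congrFun (hr (π₀ x)) i)
  let Ft : C(UnitAddTorus (Fin n), ℂ) :=
    ⟨fun z => F (Function.surjInv hq.surjective z), by
      rw [← hq.continuous_comp_iff]
      exact hFc.congr (fun x => (hFl x).symm)⟩
  have hFt : ∀ x, Ft (π₀ x) = F x := hFl
  have hcoef : ∀ k, UnitAddTorus.mFourierCoeff Ft k = ∫ y : Fin n → ℝ,
        Complex.exp (2 * Real.pi * Complex.I * ∑ i, ((-k) i : ℂ) * (y i : ℂ)) * g y := by
    intro k
    set e : (Fin n → ℝ) → ℂ := fun y =>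
      Complex.exp (2 * Real.pi * Complex.I * ∑ i, ((-k) i : ℂ) * (y i : ℂ)) with he
    have hen : ∀ y, ‖e y‖ = 1 := by
      intro y
      have : e y = Complex.exp ((2 * Real.pi * ∑ i, (-k i : ℝ) * y i : ℝ) * Complex.I) := by
        simp only [he]; congr 1; push_cast; simp; ring
      rw [this, Complex.norm_exp_ofReal_mul_I]
    have hec : Continuous e := by fun_prop
    have hep : ∀ y (m : Fin n → ℤ), e (y + fun i => (m i : ℝ)) = e y := by
      intro y m
      have h1 := mFourier_coe_aux (-k) (y + fun i => (m i : ℝ))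
      have h2 := mFourier_coe_aux (-k) y
      have h3 : (fun i => (((y + fun i => (m i : ℝ)) i : ℝ) : UnitAddCircle)) =
          fun i => ((y i : ℝ) : UnitAddCircle) := by
        funext i
        simp
      rw [h3, h2] at h1
      simpa [he] using h1.symm
    have hegi : Integrable (fun y => e y * g y) := by
      refine (integrable_norm_iff (by fun_prop)).mp ?_
      simpa [hen] using hi.norm
    rw [UnitAddTorus.mFourierCoeff_eq_integral Ft k 0]
    have hB := box_hasSum _ hegi
    have hBn := box_hasSum _ hegi.norm
    simp only [hep] at hB hBn
    rw [← hB.tsum_eq]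
    set box : Set (Fin n → ℝ) := {x : Fin n → ℝ | ∀ i, x i ∈ Set.Ioc (0:ℝ) (0 + 1)} with hbox
    have hswap := integral_tsum_of_summable_integral_norm (μ := volume.restrict box)
      (F := fun (m : Fin n → ℤ) x => e x * g (x + fun i => (m i : ℝ))) ?_ hBn.summable
    · rw [hswap]
      simp only [Pi.zero_apply]
      refine integral_congr_ae (ae_of_all _ fun y => ?_)
      simp only [tsum_mul_left]
      rw [mFourier_coe_aux (-k) y, smul_eq_mul]
      have := hFt y
      simp only [π₀] at this
      rw [this]
    · intro m
      have := (hegi.comp_add_right (fun i => (m i : ℝ))).integrableOn (s := box)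
      simp only [hep] at this
      exact this
  have hsum' : Summable (UnitAddTorus.mFourierCoeff Ft) := by
    simpa only [← hcoef] using hsum
  have fin := (UnitAddTorus.hasSum_mFourier_series_apply_of_summable hsum' (π₀ x)).tsum_eq
  rw [hFt] at fin
  simp only [F] at fin
  rw [← fin]
  refine tsum_congr fun k => ?_
  rw [hcoef, smul_eq_mul]
  congr 1
  exact mFourier_coe_aux k x
end

lemma exists_dual_aux {n : ℕ} (B : Module.Basis (Fin n) ℝ (EuclideanSpace ℝ (Fin n))) (k : Fin n → ℝ) :
    ∃ d : EuclideanSpace ℝ (Fin n), ∀ i, ⟪d, B i⟫ = k i := by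
  refine ⟨(InnerProductSpace.toDual ℝ _).symm (LinearMap.toContinuousLinearMap (B.constr ℝ k)), ?_⟩
  intro i
  rw [InnerProductSpace.toDual_symm_apply]
  simp

lemma exists_basis_aux {n : ℕ} {L : Submodule ℤ (EuclideanSpace ℝ (Fin n))}
    (hL : IsUnimodularLattice n L) :
    ∃ (b : Module.Basis (Fin n) ℤ L) (B : Module.Basis (Fin n) ℝ (EuclideanSpace ℝ (Fin n))),
      ∀ i, B i = (b i : EuclideanSpace ℝ (Fin n)) := by
  have := hL.1
  have : IsZLattice ℝ L := ⟨hL.2.1⟩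
  have := ZLattice.module_finite ℝ L
  have := ZLattice.module_free ℝ L
  have hr : Module.finrank ℤ L = n := by
    rw [ZLattice.rank ℝ L]; simp
  let b := Module.finBasisOfFinrankEq ℤ L hr
  exact ⟨b, b.ofZLatticeBasis ℝ L, fun i => b.ofZLatticeBasis_apply ℝ L i⟩

lemma inner_int_aux {n : ℕ} {L : Submodule ℤ (EuclideanSpace ℝ (Fin n))}
    (hL : IsUnimodularLattice n L) {x y : EuclideanSpace ℝ (Fin n)} (hx : x ∈ L) (hy : y ∈ L) :
    ∃ k : ℤ, ⟪x, y⟫ = (k : ℝ) := (hL.2.2 x).mp hx y hy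

lemma norm_cexp_gauss_aux (s : ℂ) (r : ℝ) :
    ‖Complex.exp (-(Real.pi * s) * (r : ℂ) ^ 2)‖ = Real.exp (-(Real.pi * s.re) * r ^ 2) := by
  rw [Complex.norm_exp]
  congr 1
  rw [← Complex.ofReal_pow, Complex.re_mul_ofReal]
  simp

open MeasureTheory in
lemma theta_poisson_const {n : ℕ} {L : Submodule ℤ (EuclideanSpace ℝ (Fin n))}
    (hL : IsUnimodularLattice n L) : ∃ κ : ℂ, ∀ (s : ℂ) (_ : 0 < s.re) (u : EuclideanSpace ℝ (Fin n)),
    ∑' v : L, Complex.exp (-(Real.pi * s) * (‖(v : EuclideanSpace ℝ (Fin n)) + u‖ : ℂ) ^ 2) =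
    κ * ((1 / s) ^ (n / 2 : ℂ) * ∑' v : L, Complex.exp (-(Real.pi * (1 / s)) *
      (‖(v : EuclideanSpace ℝ (Fin n))‖ : ℂ) ^ 2
      + 2 * Real.pi * Complex.I * (⟪(v : EuclideanSpace ℝ (Fin n)), u⟫ : ℝ))) := by
  have := hL.1
  obtain ⟨b, B, hbB⟩ := exists_basis_aux hL
  let ℓ := B.equivFun.symm
  have hℓ : ∀ x, ℓ x = ∑ i, x i • B i := fun x => B.equivFun_symm_apply x
  have hℓm : ∀ m : Fin n → ℤ, ℓ (fun i => (m i : ℝ)) = (b.equivFun.symm m : L) := by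
    intro m
    rw [hℓ, b.equivFun_symm_apply]
    push_cast
    refine Finset.sum_congr rfl fun i _ => ?_
    rw [hbB]
    exact Int.cast_smul_eq_zsmul ℝ _ _
  -- the measure constant
  let ℓc : (Fin n → ℝ) ≃L[ℝ] EuclideanSpace ℝ (Fin n) := ℓ.toContinuousLinearEquiv
  have hℓc : ∀ x, ℓc x = ℓ x := fun x => rfl
  let ℓm : (Fin n → ℝ) ≃ᵐ EuclideanSpace ℝ (Fin n) := ℓc.toHomeomorph.toMeasurableEquiv
  have hℓme : ∀ x, ℓm x = ℓ x := fun x => rfl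
  have : (Measure.map ℓc (volume : Measure (Fin n → ℝ))).IsAddHaarMeasure :=
    ContinuousLinearEquiv.isAddHaarMeasure_map ℓc volume
  let κ : NNReal := Measure.addHaarScalarFactor (Measure.map ℓc (volume : Measure (Fin n → ℝ))) (volume : Measure (EuclideanSpace ℝ (Fin n)))
  have hκ : Measure.map ℓm (volume : Measure (Fin n → ℝ)) = κ • (volume : Measure (EuclideanSpace ℝ (Fin n))) :=
    Measure.isAddLeftInvariant_eq_smul (Measure.map ℓc (volume : Measure (Fin n → ℝ))) volume
  have hchange : ∀ h : EuclideanSpace ℝ (Fin n) → ℂ, ∫ y, h (ℓ y) = (κ : ℂ) * ∫ v, h v := by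
    intro h
    have := integral_map_equiv (μ := volume) ℓm h
    rw [hκ, integral_smul_nnreal_measure] at this
    simp only [hℓme] at this
    rw [← this]
    simp [NNReal.smul_def]
  -- the dual bijection
  have hex : ∀ v : L, ∃ k : Fin n → ℤ, ∀ i, ⟪(v : EuclideanSpace ℝ (Fin n)), B i⟫ = (k i : ℝ) := by
    intro v
    have : ∀ i, ∃ k : ℤ, ⟪(v : EuclideanSpace ℝ (Fin n)), B i⟫ = (k : ℝ) := fun i => by
      rw [hbB]; exact inner_int_aux hL v.2 (b i).2
    choose k hk using this
    exact ⟨k, hk⟩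
  choose φ hφ using hex
  have hφbij : Function.Bijective φ := by
    constructor
    · intro v v' h
      apply Subtype.ext
      have h2 : innerₗ (EuclideanSpace ℝ (Fin n)) (v : EuclideanSpace ℝ (Fin n)) =
          innerₗ (EuclideanSpace ℝ (Fin n)) (v' : EuclideanSpace ℝ (Fin n)) := by
        refine B.ext fun i => ?_
        rw [innerₗ_apply_apply, innerₗ_apply_apply, hφ, hφ, h]
      exact ext_inner_right ℝ fun y => LinearMap.congr_fun h2 y
    · intro k
      obtain ⟨d, hd⟩ := exists_dual_aux B (fun i => (k i : ℝ))
      have hdL : d ∈ L := by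
        rw [hL.2.2]
        intro y hy
        refine ⟨∑ i, b.equivFun ⟨y, hy⟩ i * k i, ?_⟩
        have h1 : y = ℓ (fun i => (b.equivFun ⟨y, hy⟩ i : ℝ)) := by
          rw [hℓm]; simp
        conv_lhs => rw [h1, hℓ]
        rw [inner_sum]
        push_cast
        refine Finset.sum_congr rfl fun i _ => ?_
        rw [inner_smul_right, hd]
      refine ⟨⟨d, hdL⟩, ?_⟩
      funext i
      have := hφ ⟨d, hdL⟩ i
      rw [hd] at this
      exact_mod_cast this.symm
  let Φ : L ≃ (Fin n → ℤ) := Equiv.ofBijective φ hφbij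
  have hΦ : ∀ (v : L) (x : Fin n → ℝ), ∑ i, (φ v i : ℝ) * x i = ⟪(v : EuclideanSpace ℝ (Fin n)), ℓ x⟫ := by
    intro v x
    rw [hℓ, inner_sum]
    refine Finset.sum_congr rfl fun i _ => ?_
    rw [inner_smul_right, hφ, mul_comm]
  refine ⟨κ, fun s hs u => ?_⟩
  have hs0 : s ≠ 0 := by rintro rfl; simp at hs
  have hs' : 0 < (1 / s).re := by
    rw [one_div, Complex.inv_re]
    exact div_pos hs (Complex.normSq_pos.mpr hs0)
  let f : EuclideanSpace ℝ (Fin n) → ℂ := fun v => Complex.exp (-(Real.pi * s) * (‖v‖ : ℂ) ^ 2)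
  have hfc : Continuous f := by fun_prop
  have hbre : 0 < ((Real.pi : ℂ) * s).re := by
    rw [Complex.re_ofReal_mul]; exact mul_pos Real.pi_pos hs
  have hfi : Integrable f := by
    simpa [f] using GaussianFourier.integrable_cexp_neg_mul_sq_norm_add hbre 0 (0 : EuclideanSpace ℝ (Fin n))
  have hcoef : ∀ v : L, ∫ y : Fin n → ℝ, Complex.exp (2 * Real.pi * Complex.I *
      ∑ i, ((-(φ v)) i : ℂ) * (y i : ℂ)) * f (ℓ y) = κ * ((1 / s) ^ (n / 2 : ℂ) *
        Complex.exp (-(Real.pi * (1 / s)) * (‖(v : EuclideanSpace ℝ (Fin n))‖ : ℂ) ^ 2)) := by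
    intro v
    have h1 := hchange (fun y => Complex.exp (-(Real.pi * s) * (‖y‖ : ℂ) ^ 2 +
      (-(2 * Real.pi * Complex.I)) * (⟪(v : EuclideanSpace ℝ (Fin n)), y⟫ : ℝ)))
    rw [GaussianFourier.integral_cexp_neg_mul_sq_norm_add hbre] at h1
    convert h1 using 3
    · rename_i y
      rw [← hΦ, ← Complex.exp_add]
      congr 1
      push_cast
      simp
      ring
    · congr 1
      · have := Real.pi_ne_zero
        field_simp
      · simp
    · congr 1
      have : (Real.pi : ℂ) ≠ 0 := by exact_mod_cast Real.pi_ne_zero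
      field_simp
      rw [Complex.I_sq]
      ring
  have hsum0 : Summable fun v : L => Complex.exp (-(Real.pi * (1 / s)) * (‖(v : EuclideanSpace ℝ (Fin n))‖ : ℂ) ^ 2) := by
    apply Summable.of_norm
    simp only [norm_cexp_gauss_aux]
    exact summable_gauss0 L (mul_pos Real.pi_pos hs')
  have key := poisson_pi (fun x => f (ℓ x)) (hfc.comp ℓc.continuous) ?_ ?_ ?_ (ℓ.symm u)
  · have e1 : ∑' m : Fin n → ℤ, f (ℓ (ℓ.symm u + fun i => (m i : ℝ))) =
        ∑' v : L, Complex.exp (-(Real.pi * s) * (‖(v : EuclideanSpace ℝ (Fin n)) + u‖ : ℂ) ^ 2) := by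
      rw [← b.equivFun.symm.toEquiv.tsum_eq]
      refine tsum_congr fun m => ?_
      simp only [map_add, LinearEquiv.apply_symm_apply, hℓm, f]
      rw [add_comm]
      rfl
    rw [← e1, key, ← Φ.tsum_eq, ← tsum_mul_left, ← tsum_mul_left]
    refine tsum_congr fun v => ?_
    change (∫ y : Fin n → ℝ, Complex.exp (2 * Real.pi * Complex.I *
      ∑ i, ((-(φ v)) i : ℂ) * (y i : ℂ)) * f (ℓ y)) * Complex.exp (2 * Real.pi * Complex.I * ∑ i, (φ v i : ℂ) * (ℓ.symm u i : ℂ)) = _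
    rw [hcoef, Complex.exp_add, mul_assoc, mul_assoc]
    congr 4
    have := hΦ v (ℓ.symm u)
    rw [LinearEquiv.apply_symm_apply] at this
    rw [← this]
    push_cast
    rfl
  · have : Integrable f (Measure.map ℓm volume) := by
      rw [hκ]; exact hfi.smul_measure_nnreal
    exact (integrable_map_equiv ℓm f).mp this
  · intro R
    have hc : 0 < Real.pi * s.re := mul_pos Real.pi_pos hs
    refine ⟨fun m => Real.exp ((Real.pi * s.re) * (‖(ℓc : (Fin n → ℝ) →L[ℝ] EuclideanSpace ℝ (Fin n))‖ * R) ^ 2) *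
      Real.exp (-((Real.pi * s.re) / 2) * ‖((b.equivFun.symm m : L) : EuclideanSpace ℝ (Fin n))‖ ^ 2), ?_, ?_⟩
    · exact ((b.equivFun.symm.toEquiv.summable_iff (f := fun v : L => Real.exp (-((Real.pi * s.re) / 2) * ‖(v : EuclideanSpace ℝ (Fin n))‖ ^ 2))).mpr
        (summable_gauss0 L (half_pos hc))).mul_left _
    · intro m x hx
      simp only [f]
      rw [norm_cexp_gauss_aux, map_add, hℓm, add_comm]
      refine (gauss_exp_bound hc.le _ _).trans ?_
      have hx' : ‖x‖ ≤ R := by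
        rw [mem_ball_zero_iff] at hx; exact hx.le
      have : ‖ℓ x‖ ≤ ‖(ℓc : (Fin n → ℝ) →L[ℝ] EuclideanSpace ℝ (Fin n))‖ * R :=
        ((ℓc : (Fin n → ℝ) →L[ℝ] EuclideanSpace ℝ (Fin n)).le_opNorm x).trans (by gcongr)
      gcongr
  · rw [← Φ.summable_iff]
    refine ((hsum0.mul_left ((1 / s) ^ (n / 2 : ℂ))).mul_left (κ : ℂ)).congr fun v => ?_
    exact (hcoef v).symm

lemma theta_poisson {n : ℕ} {L : Submodule ℤ (EuclideanSpace ℝ (Fin n))}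
    (hL : IsUnimodularLattice n L) (s : ℂ) (hs : 0 < s.re) (u : EuclideanSpace ℝ (Fin n)) :
    ∑' v : L, Complex.exp (-(Real.pi * s) * (‖(v : EuclideanSpace ℝ (Fin n)) + u‖ : ℂ) ^ 2) =
    (1 / s) ^ (n / 2 : ℂ) * ∑' v : L, Complex.exp (-(Real.pi * (1 / s)) *
      (‖(v : EuclideanSpace ℝ (Fin n))‖ : ℂ) ^ 2
      + 2 * Real.pi * Complex.I * (⟪(v : EuclideanSpace ℝ (Fin n)), u⟫ : ℝ)) := by
  have := hL.1
  obtain ⟨κ, hκ⟩ := theta_poisson_const hL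
  have h1 := hκ 1 (by simp) 0
  simp only [add_zero, inner_zero_right, Complex.ofReal_zero, mul_zero, div_one, mul_one,
    Complex.one_cpow, one_mul] at h1
  have h2 : ∑' v : L, Complex.exp (-(Real.pi : ℂ) * (‖(v : EuclideanSpace ℝ (Fin n))‖ : ℂ) ^ 2) =
      ((∑' v : L, Real.exp (-Real.pi * ‖(v : EuclideanSpace ℝ (Fin n))‖ ^ 2) : ℝ) : ℂ) := by
    push_cast
    rfl
  have h3 : 0 < ∑' v : L, Real.exp (-Real.pi * ‖(v : EuclideanSpace ℝ (Fin n))‖ ^ 2) :=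
    (summable_gauss0 L Real.pi_pos).tsum_pos (fun _ => (Real.exp_pos _).le) 0 (Real.exp_pos _)
  rw [h2] at h1
  have h4 : κ = 1 := by
    have : ((∑' v : L, Real.exp (-Real.pi * ‖(v : EuclideanSpace ℝ (Fin n))‖ ^ 2) : ℝ) : ℂ) ≠ 0 := by
      exact_mod_cast h3.ne'
    exact mul_right_cancel₀ this (by rw [← h1, one_mul])
  rw [hκ s hs u, h4, one_mul]

/-- The theta series of the translate `L + u`. -/
noncomputable def thetaL {n : ℕ} (L : Submodule ℤ (EuclideanSpace ℝ (Fin n)))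
    (u : EuclideanSpace ℝ (Fin n)) (t : ℂ) : ℂ :=
  ∑' v : L, Complex.exp (-(Real.pi * (-(Complex.I * t))) *
    (‖(v : EuclideanSpace ℝ (Fin n)) + u‖ : ℂ) ^ 2)

lemma re_aux (t : ℂ) : (-(Complex.I * t)).re = t.im := by simp

lemma thetaL_term_norm (t : ℂ) (r : ℝ) :
    ‖Complex.exp (-(Real.pi * (-(Complex.I * t))) * (r : ℂ) ^ 2)‖ =
      Real.exp (-(Real.pi * t.im) * r ^ 2) := by
  rw [norm_cexp_gauss_aux, re_aux]

lemma thetaL_differentiableOn {n : ℕ} (L : Submodule ℤ (EuclideanSpace ℝ (Fin n)))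
    [DiscreteTopology L] (u : EuclideanSpace ℝ (Fin n)) :
    DifferentiableOn ℂ (thetaL L u) {t | 0 < t.im} := by
  intro t ht
  have ht' : 0 < t.im := ht
  have hopen : IsOpen {z : ℂ | t.im / 2 < z.im} := isOpen_lt continuous_const Complex.continuous_im
  have : DifferentiableOn ℂ (thetaL L u) {z : ℂ | t.im / 2 < z.im} := by
    refine Complex.differentiableOn_tsum_of_summable_norm
      (summable_gauss L (mul_pos Real.pi_pos (half_pos ht')) u) (fun v => ?_) hopen
      (fun v z hz => ?_)
    · fun_prop
    · rw [thetaL_term_norm]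
      have hz' : t.im / 2 < z.im := hz
      apply Real.exp_le_exp.mpr
      have := Real.pi_pos
      rw [neg_mul, neg_mul, neg_le_neg_iff]
      gcongr
  refine (this.differentiableAt (hopen.mem_nhds ?_)).differentiableWithinAt
  change t.im / 2 < t.im
  linarith

lemma exists_characteristic {n : ℕ} {L : Submodule ℤ (EuclideanSpace ℝ (Fin n))}
    (hL : IsUnimodularLattice n L) : ∃ w, IsCharacteristic n L w := by
  obtain ⟨b, B, hbB⟩ := exists_basis_aux hL
  obtain ⟨w, hw⟩ := exists_dual_aux B (fun i => ⟪B i, B i⟫)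
  have key : ∀ x : L, ∃ k : ℤ, ⟪w, (x : EuclideanSpace ℝ (Fin n))⟫ -
      ⟪(x : EuclideanSpace ℝ (Fin n)), (x : EuclideanSpace ℝ (Fin n))⟫ = 2 * (k : ℝ) := by
    let S : AddSubgroup L :=
      { carrier := {x | ∃ k : ℤ, ⟪w, (x : EuclideanSpace ℝ (Fin n))⟫ -
          ⟪(x : EuclideanSpace ℝ (Fin n)), (x : EuclideanSpace ℝ (Fin n))⟫ = 2 * (k : ℝ)}
        zero_mem' := ⟨0, by simp⟩
        add_mem' := by
          rintro x y ⟨k, hk⟩ ⟨l, hl⟩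
          obtain ⟨m, hm⟩ := inner_int_aux hL x.2 y.2
          refine ⟨k + l - m, ?_⟩
          have := real_inner_comm (x : EuclideanSpace ℝ (Fin n)) (y : EuclideanSpace ℝ (Fin n))
          push_cast
          simp only [inner_add_left, inner_add_right]
          linarith
        neg_mem' := by
          rintro x ⟨k, hk⟩
          obtain ⟨m, hm⟩ := inner_int_aux hL x.2 x.2
          refine ⟨-k - m, ?_⟩
          push_cast
          simp only [inner_neg_left, inner_neg_right]
          linarith }
    have hS : ∀ i, b i ∈ S := fun i => ⟨0, by rw [← hbB, hw]; simp⟩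
    intro x
    change x ∈ S
    rw [← b.sum_repr x]
    exact S.sum_mem fun i _ => S.zsmul_mem (hS i) _
  refine ⟨w, ?_, fun x hx => key ⟨x, hx⟩⟩
  rw [hL.2.2]
  intro y hy
  obtain ⟨k, hk⟩ := key ⟨y, hy⟩
  obtain ⟨m, hm⟩ := inner_int_aux hL hy hy
  refine ⟨2 * k + m, ?_⟩
  push_cast
  simp only at hk
  linarith

lemma norm_sq_int {n : ℕ} {L : Submodule ℤ (EuclideanSpace ℝ (Fin n))}
    (hL : IsUnimodularLattice n L) (v : L) : ∃ k : ℤ, ‖(v : EuclideanSpace ℝ (Fin n))‖ ^ 2 = (k : ℝ) := by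
  rw [← real_inner_self_eq_norm_sq]
  exact inner_int_aux hL v.2 v.2

lemma cexp_int_aux {x y : ℂ} (k : ℤ) (h : x = y + k * (2 * Real.pi * Complex.I)) :
    Complex.exp x = Complex.exp y := by
  rw [h, Complex.exp_add, Complex.exp_int_mul_two_pi_mul_I, mul_one]

lemma thetaL_add_two {n : ℕ} {L : Submodule ℤ (EuclideanSpace ℝ (Fin n))}
    (hL : IsUnimodularLattice n L) (t : ℂ) : thetaL L 0 (t + 1 + 1) = thetaL L 0 t := by
  refine tsum_congr fun v => ?_
  obtain ⟨k, hk⟩ := norm_sq_int hL v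
  refine cexp_int_aux k ?_
  simp only [add_zero]
  rw [← Complex.ofReal_pow, hk]
  push_cast
  ring

lemma thetaL_add_one {n : ℕ} {L : Submodule ℤ (EuclideanSpace ℝ (Fin n))}
    {w : EuclideanSpace ℝ (Fin n)} (hw : IsCharacteristic n L w) (t : ℂ) :
    thetaL L 0 (t + 1) = ∑' v : L, Complex.exp (-(Real.pi * (-(Complex.I * t))) *
      (‖(v : EuclideanSpace ℝ (Fin n))‖ : ℂ) ^ 2
      + 2 * Real.pi * Complex.I * (⟪(v : EuclideanSpace ℝ (Fin n)), (1 / 2 : ℝ) • w⟫ : ℝ)) := by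
  refine tsum_congr fun v => ?_
  obtain ⟨k, hk⟩ := hw.2 v v.2
  refine cexp_int_aux (-k) ?_
  rw [inner_smul_right, real_inner_comm]
  have h1 : ⟪w, (v : EuclideanSpace ℝ (Fin n))⟫ = ‖(v : EuclideanSpace ℝ (Fin n))‖ ^ 2 + 2 * k := by
    rw [← real_inner_self_eq_norm_sq]; linarith
  rw [h1]
  simp only [add_zero]
  push_cast
  ring

lemma thetaL_char_add_one {n : ℕ} {L : Submodule ℤ (EuclideanSpace ℝ (Fin n))}
    (hL : IsUnimodularLattice n L)
    {w : EuclideanSpace ℝ (Fin n)} (hw : IsCharacteristic n L w) (t : ℂ) :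
    thetaL L ((1 / 2 : ℝ) • w) (t + 1) ^ 8 = thetaL L ((1 / 2 : ℝ) • w) t ^ 8 := by
  have h1 : thetaL L ((1 / 2 : ℝ) • w) (t + 1) =
      Complex.exp (Real.pi * Complex.I * (‖w‖ ^ 2 / 4 : ℝ)) * thetaL L ((1 / 2 : ℝ) • w) t := by
    unfold thetaL
    rw [← tsum_mul_left]
    refine tsum_congr fun v => ?_
    rw [← Complex.exp_add]
    obtain ⟨k, hk⟩ := hw.2 v v.2
    obtain ⟨m, hm⟩ := norm_sq_int hL v
    refine cexp_int_aux (m + k) ?_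
    have h2 : ‖(v : EuclideanSpace ℝ (Fin n)) + (1 / 2 : ℝ) • w‖ ^ 2 = 2 * (m + k) + ‖w‖ ^ 2 / 4 := by
      rw [real_inner_self_eq_norm_sq, hm] at hk
      rw [norm_add_sq_real, inner_smul_right, norm_smul, hm, real_inner_comm, mul_pow]
      norm_num
      linarith
    rw [← Complex.ofReal_pow, h2]
    push_cast
    ring
  obtain ⟨k, hk⟩ := norm_sq_int hL ⟨w, hw.1⟩
  simp only at hk
  rw [h1, mul_pow, ← Complex.exp_nat_mul]
  rw [show Complex.exp ((8 : ℕ) * (Real.pi * Complex.I * (‖w‖ ^ 2 / 4 : ℝ))) = 1 by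
    rw [← Complex.exp_zero]
    refine cexp_int_aux k ?_
    rw [hk]
    push_cast
    ring]
  rw [one_mul]

lemma S_im_aux {t : ℂ} (ht : 0 < t.im) : 0 < (-1 / t).im := by
  have h0 : t ≠ 0 := by rintro rfl; simp at ht
  rw [neg_div, one_div, Complex.neg_im, Complex.inv_im]
  have := Complex.normSq_pos.mpr h0
  rw [← neg_div, neg_neg]
  positivity

lemma pow_eight_aux (n : ℕ) (t : ℂ) : ((-(Complex.I * t)) ^ (n / 2 : ℂ)) ^ 8 = t ^ (4 * n) := by
  rw [← Complex.cpow_nat_mul]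
  rw [show ((8 : ℕ) : ℂ) * (n / 2 : ℂ) = ((4 * n : ℕ) : ℂ) by push_cast; ring]
  rw [Complex.cpow_natCast, pow_mul, pow_mul]
  congr 1
  rw [neg_pow, mul_pow, Complex.I_pow_four]
  norm_num

lemma thetaL_S {n : ℕ} {L : Submodule ℤ (EuclideanSpace ℝ (Fin n))}
    (hL : IsUnimodularLattice n L) {t : ℂ} (ht : 0 < t.im) (u : EuclideanSpace ℝ (Fin n)) :
    thetaL L u (-1 / t) ^ 8 = t ^ (4 * n) * (∑' v : L, Complex.exp (-(Real.pi * (-(Complex.I * t))) *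
      (‖(v : EuclideanSpace ℝ (Fin n))‖ : ℂ) ^ 2
      + 2 * Real.pi * Complex.I * (⟪(v : EuclideanSpace ℝ (Fin n)), u⟫ : ℝ))) ^ 8 := by
  have h0 : t ≠ 0 := by rintro rfl; simp at ht
  unfold thetaL
  rw [theta_poisson hL _ (by rw [re_aux]; exact S_im_aux ht) u, mul_pow]
  have h1 : 1 / (-(Complex.I * (-1 / t))) = -(Complex.I * t) := by
    have := Complex.I_ne_zero
    field_simp
    simp
  rw [h1, pow_eight_aux]

lemma thetaL_S_zero {n : ℕ} {L : Submodule ℤ (EuclideanSpace ℝ (Fin n))}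
    (hL : IsUnimodularLattice n L) {t : ℂ} (ht : 0 < t.im) :
    thetaL L 0 (-1 / t) ^ 8 = t ^ (4 * n) * thetaL L 0 t ^ 8 := by
  rw [thetaL_S hL ht]
  simp [thetaL]

lemma thetaL_S_char {n : ℕ} {L : Submodule ℤ (EuclideanSpace ℝ (Fin n))}
    (hL : IsUnimodularLattice n L) {w : EuclideanSpace ℝ (Fin n)} (hw : IsCharacteristic n L w)
    {t : ℂ} (ht : 0 < t.im) :
    thetaL L ((1 / 2 : ℝ) • w) (-1 / t) ^ 8 = t ^ (4 * n) * thetaL L 0 (t + 1) ^ 8 := by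
  rw [thetaL_S hL ht, thetaL_add_one hw]

lemma thetaL_S_char' {n : ℕ} {L : Submodule ℤ (EuclideanSpace ℝ (Fin n))}
    (hL : IsUnimodularLattice n L) {w : EuclideanSpace ℝ (Fin n)} (hw : IsCharacteristic n L w)
    {t : ℂ} (ht : 0 < t.im) :
    thetaL L 0 (-1 / t + 1) ^ 8 = t ^ (4 * n) * thetaL L ((1 / 2 : ℝ) • w) t ^ 8 := by
  have h0 : t ≠ 0 := by rintro rfl; simp at ht
  have h := thetaL_S_char hL hw (S_im_aux ht)
  rw [show -1 / (-1 / t) = t by field_simp] at h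
  rw [h, ← mul_assoc, ← mul_pow, show t * (-1 / t) = -1 by field_simp, pow_mul]
  norm_num

open UpperHalfPlane Filter Topology in
lemma thetaL_tendsto_one {n : ℕ} (L : Submodule ℤ (EuclideanSpace ℝ (Fin n)))
    [DiscreteTopology L] : Tendsto (fun τ : ℍ => thetaL L 0 (τ : ℂ)) atImInfty (𝓝 1) := by
  have h1 : (1 : ℂ) = ∑' v : L, if v = 0 then (1 : ℂ) else 0 := by rw [tsum_ite_eq]
  rw [h1]
  have him : Tendsto UpperHalfPlane.im atImInfty atTop := tendsto_comap
  refine tendsto_tsum_of_dominated_convergence (summable_gauss0 L Real.pi_pos) (fun v => ?_) ?_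
  · split_ifs with hv
    · subst hv; simp
    · rw [tendsto_zero_iff_norm_tendsto_zero]
      simp only [thetaL_term_norm, add_zero]
      have hv' : 0 < ‖(v : EuclideanSpace ℝ (Fin n))‖ := norm_pos_iff.mpr (by simpa using hv)
      refine Real.tendsto_exp_atBot.comp ?_
      have : Tendsto (fun τ : ℍ => (-(Real.pi * ‖(v : EuclideanSpace ℝ (Fin n))‖ ^ 2)) * τ.im) atImInfty atBot :=
        him.const_mul_atTop_of_neg (by have := Real.pi_pos; simp only [neg_lt_zero]; positivity)
      refine this.congr fun τ => ?_
      simp only [UpperHalfPlane.coe_im]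
      ring
  · filter_upwards [him.eventually_ge_atTop 1] with τ hτ v
    rw [thetaL_term_norm, add_zero]
    apply Real.exp_le_exp.mpr
    have := Real.pi_pos
    simp only [neg_mul, neg_le_neg_iff, UpperHalfPlane.coe_im]
    have h3 : 0 ≤ ‖(v : EuclideanSpace ℝ (Fin n))‖ ^ 2 := by positivity
    nlinarith [mul_nonneg this.le h3]

open UpperHalfPlane Filter Topology Asymptotics in
lemma thetaL_char_isBigO {n : ℕ} {L : Submodule ℤ (EuclideanSpace ℝ (Fin n))}
    (hL : IsUnimodularLattice n L)
    (h : ∀ w : EuclideanSpace ℝ (Fin n), IsCharacteristic n L w → (n : ℝ) ≤ ⟪w, w⟫)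
    {w : EuclideanSpace ℝ (Fin n)} (hw : IsCharacteristic n L w) :
    (fun τ : ℍ => thetaL L ((1 / 2 : ℝ) • w) (τ : ℂ) ^ 8) =O[atImInfty]
      fun τ : ℍ => Real.exp (-2 * Real.pi * τ.im) ^ n := by
  have := hL.1
  have him : Tendsto UpperHalfPlane.im atImInfty atTop := tendsto_comap
  have hpi := Real.pi_pos
  have hlow : ∀ v : L, (n : ℝ) / 4 ≤ ‖(v : EuclideanSpace ℝ (Fin n)) + (1 / 2 : ℝ) • w‖ ^ 2 := by
    intro v
    have hc : IsCharacteristic n L ((2 : ℤ) • (v : EuclideanSpace ℝ (Fin n)) + w) := by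
      refine ⟨L.add_mem (L.smul_mem _ v.2) hw.1, fun x hx => ?_⟩
      obtain ⟨k, hk⟩ := hw.2 x hx
      obtain ⟨m, hm⟩ := inner_int_aux hL v.2 hx
      refine ⟨k + m, ?_⟩
      rw [two_smul, inner_add_left, inner_add_left, hm]
      push_cast
      linarith
    have h2 := h _ hc
    have h3 : (2 : ℤ) • (v : EuclideanSpace ℝ (Fin n)) + w =
        (2 : ℝ) • ((v : EuclideanSpace ℝ (Fin n)) + (1 / 2 : ℝ) • w) := by
      rw [smul_add, smul_smul, two_smul, two_smul]; norm_num
    rw [h3, real_inner_self_eq_norm_sq, norm_smul, mul_pow] at h2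
    norm_num at h2
    norm_num
    linarith
  have hsum := summable_gauss L hpi ((1 / 2 : ℝ) • w)
  set K := ∑' v : L, Real.exp (-Real.pi * ‖(v : EuclideanSpace ℝ (Fin n)) + (1 / 2 : ℝ) • w‖ ^ 2) with hK
  have hmain : (fun τ : ℍ => thetaL L ((1 / 2 : ℝ) • w) (τ : ℂ)) =O[atImInfty]
      fun τ : ℍ => Real.exp (-(Real.pi * (n / 4)) * τ.im) := by
    refine IsBigO.of_bound (Real.exp (Real.pi * (n / 4)) * K) ?_
    filter_upwards [him.eventually_ge_atTop 1] with τ hτ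
    have hb : ∀ v : L, ‖Complex.exp (-(Real.pi * (-(Complex.I * (τ : ℂ)))) *
        (‖(v : EuclideanSpace ℝ (Fin n)) + (1 / 2 : ℝ) • w‖ : ℂ) ^ 2)‖ ≤
        (Real.exp (Real.pi * (n / 4)) * Real.exp (-(Real.pi * (n / 4)) * τ.im)) *
         Real.exp (-Real.pi * ‖(v : EuclideanSpace ℝ (Fin n)) + (1 / 2 : ℝ) • w‖ ^ 2) := by
      intro v
      rw [thetaL_term_norm, ← Real.exp_add, ← Real.exp_add]
      apply Real.exp_le_exp.mpr
      simp only [UpperHalfPlane.coe_im]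
      have h1 := mul_nonneg hpi.le (mul_nonneg (sub_nonneg.mpr hτ) (sub_nonneg.mpr (hlow v)))
      nlinarith
    refine (tsum_of_norm_bounded (hsum.hasSum.mul_left _) hb).trans ?_
    rw [Real.norm_of_nonneg (Real.exp_pos _).le]
    apply le_of_eq
    ring
  refine (hmain.pow 8).trans (isBigO_of_le _ fun τ => ?_)
  apply le_of_eq
  congr 1
  rw [← Real.exp_nat_mul, ← Real.exp_nat_mul]
  congr 1
  push_cast
  ring

open UpperHalfPlane ModularForm in
open scoped ModularForm MatrixGroups in
lemma disc_T_aux (τ : ℍ) :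
    ModularForm.discriminant ((1 : ℝ) +ᵥ τ) = ModularForm.discriminant τ := by
  have h := congrFun discriminant_T_invariant τ
  have hd : denom (ModularGroup.T : GL (Fin 2) ℝ) τ = 1 := by
    rw [ModularGroup.denom_apply]
    simp [ModularGroup.T]
  rw [SL_slash_apply] at h
  rw [hd, one_zpow, mul_one, modular_T_smul] at h
  exact h

open UpperHalfPlane ModularForm in
open scoped ModularForm MatrixGroups in
lemma disc_S_aux (τ : ℍ) : ModularForm.discriminant (ModularGroup.S • τ)
      = (τ : ℂ) ^ 12 * ModularForm.discriminant τ := by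
  have h := congrFun discriminant_S_invariant τ
  rw [SL_slash_apply] at h
  rw [ModularGroup.denom_S] at h
  rw [← h]
  have h0 : (τ : ℂ) ≠ 0 := τ.ne_zero
  field_simp

open UpperHalfPlane ModularForm CuspForm Filter Asymptotics SlashInvariantForm in
open scoped ModularForm MatrixGroups Manifold Topology in
lemma level_one_vanish (n : ℕ) (P : ℍ → ℂ) (hol : MDiff P)
    (hT : ∀ τ : ℍ, P ((1 : ℝ) +ᵥ τ) = P τ)
    (hS : ∀ τ : ℍ, P (ModularGroup.S • τ) = (τ : ℂ) ^ (12 * n) * P τ)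
    (hinf : P =o[atImInfty] fun τ : ℍ => Real.exp (-2 * Real.pi * τ.im) ^ n) :
    ∀ τ, P τ = 0 := by
  have hΔT := disc_T_aux
  have hΔS := disc_S_aux
  let Q : ℍ → ℂ := fun τ => P τ / ModularForm.discriminant τ ^ n
  have hQS : Q ∣[(0 : ℤ)] ModularGroup.S = Q := by
    ext τ
    rw [SL_slash_apply]
    have h0 : (τ : ℂ) ≠ 0 := τ.ne_zero
    simp only [Q, hS, hΔS, neg_zero, zpow_zero, mul_one, mul_pow, ← pow_mul]
    rw [mul_div_mul_left _ _ (pow_ne_zero _ h0)]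
  have hQT : Q ∣[(0 : ℤ)] ModularGroup.T = Q := by
    ext τ
    rw [SL_slash_apply, modular_T_smul]
    simp only [Q, hT, hΔT, neg_zero, zpow_zero, mul_one]
  have hQ0 : Tendsto Q atImInfty (𝓝 0) := by
    have h1 : P =o[atImInfty] fun τ => ModularForm.discriminant τ ^ n :=
      hinf.trans_isBigO (exp_isBigO_discriminant.pow n)
    exact h1.tendsto_div_nhds_zero
  have hQ : IsBoundedAtImInfty Q := hQ0.isBigO_one ℝ
  let F : ModularForm 𝒮ℒ 0 :=
    { toFun := Q
      slash_action_eq' := by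
        intro A hA
        obtain ⟨A, rfl⟩ := hA
        exact slash_action_generators_SL2Z hQS hQT A
      holo' := by
        have h2 : MDiff (fun τ => ModularForm.discriminant τ ^ n) :=
          CuspForm.discriminant.holo'.pow n
        exact hol.div h2 (fun τ => pow_ne_zero _ (discriminant_ne_zero τ))
      bdd_at_cusps' := by
        intro c hc
        rw [Subgroup.IsArithmetic.isCusp_iff_isCusp_SL2Z] at hc
        rw [OnePoint.isBoundedAt_iff_forall_SL2Z hc]
        intro γ _
        rw [slash_action_generators_SL2Z hQS hQT]
        exact hQ }
  obtain ⟨c, hc⟩ := ModularFormClass.levelOne_weight_zero_const F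
  have hc' : Q = Function.const _ c := hc
  have hc0 : c = 0 := by
    rw [hc'] at hQ0
    exact tendsto_nhds_unique tendsto_const_nhds hQ0
  intro τ
  have := congrFun hc' τ
  rw [hc0] at this
  simpa [Q, discriminant_ne_zero] using this

open UpperHalfPlane Filter Topology Asymptotics in
open scoped ModularForm MatrixGroups Manifold in
lemma theta_comparison {n : ℕ} {L L' : Submodule ℤ (EuclideanSpace ℝ (Fin n))}
    (hL : IsUnimodularLattice n L)
    (h : ∀ w : EuclideanSpace ℝ (Fin n), IsCharacteristic n L w → (n : ℝ) ≤ ⟪w, w⟫)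
    (hL' : IsUnimodularLattice n L')
    (h' : ∀ w : EuclideanSpace ℝ (Fin n), IsCharacteristic n L' w → (n : ℝ) ≤ ⟪w, w⟫) :
    ∀ t : ℂ, 0 < t.im → thetaL L 0 t ^ 8 = thetaL L' 0 t ^ 8 := by
  obtain ⟨w, hw⟩ := exists_characteristic hL
  obtain ⟨w', hw'⟩ := exists_characteristic hL'
  have i1 := hL.1
  have i2 := hL'.1
  set D : ℂ → ℂ := fun t => thetaL L 0 t ^ 8 - thetaL L' 0 t ^ 8 with hD
  set G : ℂ → ℂ := fun t => thetaL L ((1 / 2 : ℝ) • w) t ^ 8 -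
    thetaL L' ((1 / 2 : ℝ) • w') t ^ 8 with hG
  have dD : DifferentiableOn ℂ D {t | 0 < t.im} :=
    ((thetaL_differentiableOn L 0).pow 8).sub ((thetaL_differentiableOn L' 0).pow 8)
  have dG : DifferentiableOn ℂ G {t | 0 < t.im} :=
    ((thetaL_differentiableOn L _).pow 8).sub ((thetaL_differentiableOn L' _).pow 8)
  have dD1 : DifferentiableOn ℂ (fun t => D (t + 1)) {t | 0 < t.im} := by
    refine dD.comp (f := fun t : ℂ => t + 1) (by fun_prop) ?_
    intro t ht
    simpa using ht
  have D2 : ∀ t, D (t + 1 + 1) = D t := by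
    intro t
    simp only [hD, thetaL_add_two hL, thetaL_add_two hL']
  have G1 : ∀ t, G (t + 1) = G t := by
    intro t
    simp only [hG, thetaL_char_add_one hL hw, thetaL_char_add_one hL' hw']
  have DS : ∀ t : ℂ, 0 < t.im → D (-1 / t) = t ^ (4 * n) * D t := by
    intro t ht
    simp only [hD, thetaL_S_zero hL ht, thetaL_S_zero hL' ht, mul_sub]
  have GS : ∀ t : ℂ, 0 < t.im → G (-1 / t) = t ^ (4 * n) * D (t + 1) := by
    intro t ht
    simp only [hD, hG, thetaL_S_char hL hw ht, thetaL_S_char hL' hw' ht, mul_sub]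
  have DS1 : ∀ t : ℂ, 0 < t.im → D (-1 / t + 1) = t ^ (4 * n) * G t := by
    intro t ht
    simp only [hD, hG, thetaL_S_char' hL hw ht, thetaL_S_char' hL' hw' ht, mul_sub]
  have hDlim : Tendsto (fun τ : ℍ => D (τ : ℂ)) atImInfty (𝓝 0) := by
    have := ((thetaL_tendsto_one L).pow 8).sub ((thetaL_tendsto_one L').pow 8)
    simpa using this
  have hcoe : ∀ τ : ℍ, ((((1 : ℝ) +ᵥ τ : ℍ)) : ℂ) = (τ : ℂ) + 1 := by
    intro τ
    rw [UpperHalfPlane.coe_vadd]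
    push_cast
    ring
  have hshift : Tendsto (fun τ : ℍ => (1 : ℝ) +ᵥ τ) atImInfty atImInfty := by
    rw [atImInfty, tendsto_comap_iff]
    refine tendsto_comap.congr fun τ => ?_
    simp
  have hD1lim : Tendsto (fun τ : ℍ => D ((τ : ℂ) + 1)) atImInfty (𝓝 0) := by
    refine (hDlim.comp hshift).congr fun τ => ?_
    simp only [Function.comp, hcoe]
  have hGO : (fun τ : ℍ => G (τ : ℂ)) =O[atImInfty]
      fun τ : ℍ => Real.exp (-2 * Real.pi * τ.im) ^ n :=
    (thetaL_char_isBigO hL h hw).sub (thetaL_char_isBigO hL' h' hw')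
  have key : ∀ τ : ℍ, D (τ : ℂ) * D ((τ : ℂ) + 1) * G (τ : ℂ) = 0 := by
    refine level_one_vanish n (fun τ : ℍ => D (τ : ℂ) * D ((τ : ℂ) + 1) * G (τ : ℂ)) ?_ ?_ ?_ ?_
    · rw [UpperHalfPlane.mdifferentiable_iff]
      refine ((dD.mul dD1).mul dG).congr ?_
      intro t ht
      simp [UpperHalfPlane.ofComplex_apply_of_im_pos ht]
    · intro τ
      simp only [hcoe, D2, G1]
      ring
    · intro τ
      have hc : ((ModularGroup.S • τ : ℍ) : ℂ) = -1 / (τ : ℂ) := by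
        rw [UpperHalfPlane.modular_S_smul]
        change (-(τ : ℂ))⁻¹ = _
        rw [inv_neg, neg_div, one_div]
      simp only [hc, DS _ τ.im_pos, GS _ τ.im_pos, DS1 _ τ.im_pos]
      ring
    · have a1 : (fun τ : ℍ => D (τ : ℂ) * D ((τ : ℂ) + 1)) =o[atImInfty]
          fun _ => (1 : ℝ) := by
        rw [isLittleO_one_iff]
        simpa using hDlim.mul hD1lim
      simpa using a1.mul_isBigO hGO
  have hopen : IsOpen {t : ℂ | 0 < t.im} := isOpen_lt continuous_const Complex.continuous_im
  have hconn : IsPreconnected {t : ℂ | 0 < t.im} := (convex_halfSpace_im_gt 0).isPreconnected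
  have aD := dD.analyticOnNhd hopen
  have aD1 := dD1.analyticOnNhd hopen
  have aG := dG.analyticOnNhd hopen
  have hD1zero : (∀ t ∈ {t : ℂ | 0 < t.im}, D (t + 1) = 0) → ∀ t : ℂ, 0 < t.im → D t = 0 := by
    intro H t ht
    have := H (t - 1) (by simpa using ht)
    simpa using this
  have hD0 : ∀ t : ℂ, 0 < t.im → D t = 0 := by
    rcases AnalyticOnNhd.eq_zero_or_eq_zero_of_mul_eq_zero (aD.mul aD1) aG
      (fun z hz => key ⟨z, hz⟩) hconn with H | H
    · rcases AnalyticOnNhd.eq_zero_or_eq_zero_of_mul_eq_zero aD aD1 H hconn with H | H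
      · exact H
      · exact hD1zero H
    · apply hD1zero
      intro t ht
      have ht' : 0 < t.im := ht
      have h0 : t ≠ 0 := by rintro rfl; simp at ht'
      have := GS t ht
      rw [H _ (S_im_aux ht)] at this
      simpa [h0] using this.symm
  intro t ht
  exact sub_eq_zero.mp (hD0 t ht)

lemma zn_mem_iff (n : ℕ) (v : EuclideanSpace ℝ (Fin n)) :
    v ∈ Submodule.span ℤ (Set.range (EuclideanSpace.basisFun (Fin n) ℝ)) ↔
      ∀ i, ∃ k : ℤ, v i = k := by
  have := (EuclideanSpace.basisFun (Fin n) ℝ).toBasis.mem_span_iff_repr_mem ℤ v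
  rw [OrthonormalBasis.coe_toBasis] at this
  rw [this]
  simp [eq_comm]

lemma zn_unimodular (n : ℕ) : IsUnimodularLattice n
    (Submodule.span ℤ (Set.range (EuclideanSpace.basisFun (Fin n) ℝ))) := by
  have hb := (EuclideanSpace.basisFun (Fin n) ℝ).coe_toBasis
  refine ⟨?_, ?_, fun v => ⟨fun hv y hy => ?_, fun hv => ?_⟩⟩
  · rw [← hb]
    infer_instance
  · rw [eq_top_iff, ← (EuclideanSpace.basisFun (Fin n) ℝ).toBasis.span_eq, hb]
    exact Submodule.span_mono Submodule.subset_span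
  · rw [zn_mem_iff] at hv hy
    choose a ha using hv
    choose b hb using hy
    refine ⟨∑ i, a i * b i, ?_⟩
    rw [PiLp.inner_apply]
    push_cast
    refine Finset.sum_congr rfl fun i _ => ?_
    simp [ha, hb, mul_comm]
  · rw [zn_mem_iff]
    intro i
    obtain ⟨k, hk⟩ := hv (EuclideanSpace.basisFun (Fin n) ℝ i)
      (Submodule.subset_span ⟨i, rfl⟩)
    refine ⟨k, ?_⟩
    rw [← hk]
    simp [EuclideanSpace.inner_single_right]

lemma zn_char (n : ℕ) (w : EuclideanSpace ℝ (Fin n)) (hw : IsCharacteristic n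
    (Submodule.span ℤ (Set.range (EuclideanSpace.basisFun (Fin n) ℝ))) w) :
    (n : ℝ) ≤ ⟪w, w⟫ := by
  rw [PiLp.inner_apply]
  have : ∀ i, (1 : ℝ) ≤ ⟪w i, w i⟫ := by
    intro i
    obtain ⟨k, hk⟩ := hw.2 (EuclideanSpace.basisFun (Fin n) ℝ i)
      (Submodule.subset_span ⟨i, rfl⟩)
    have hk' : w i = ((2 * k + 1 : ℤ) : ℝ) := by
      simp [EuclideanSpace.inner_single_right] at hk
      push_cast
      linarith
    have h1 : (1 : ℤ) ≤ (2 * k + 1) * (2 * k + 1) := by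
      rcases le_or_gt 0 k with h | h <;> nlinarith
    rw [hk']
    simp only [RCLike.inner_apply, conj_trivial]
    exact_mod_cast h1
  calc (n : ℝ) = ∑ i : Fin n, (1 : ℝ) := by simp
    _ ≤ _ := Finset.sum_le_sum fun i _ => this i

lemma unit_summable {n : ℕ} (L : Submodule ℤ (EuclideanSpace ℝ (Fin n))) [DiscreteTopology L] :
    Summable fun v : L => if ‖(v : EuclideanSpace ℝ (Fin n))‖ = 1 then (1 : ℝ) else 0 := by
  refine Summable.of_nonneg_of_le (fun v => ?_) (fun v => ?_)
    ((summable_gauss0 L Real.pi_pos).mul_left (Real.exp Real.pi))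
  · split_ifs <;> norm_num
  · split_ifs with hv
    · rw [hv, ← Real.exp_add]
      simp
    · positivity

lemma unit_finite {n : ℕ} (L : Submodule ℤ (EuclideanSpace ℝ (Fin n))) [DiscreteTopology L] :
    {v : L | ‖(v : EuclideanSpace ℝ (Fin n))‖ = 1}.Finite := by
  have h1 := (unit_summable L).tendsto_cofinite_zero.eventually (gt_mem_nhds one_pos)
  refine (Filter.eventually_cofinite.mp h1).subset ?_
  intro v hv
  have hv' : ‖(v : EuclideanSpace ℝ (Fin n))‖ = 1 := hv
  simp [hv']

/-- The theta series on the imaginary axis, as a real series. -/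
noncomputable def thetaR {n : ℕ} (L : Submodule ℤ (EuclideanSpace ℝ (Fin n))) (y : ℝ) : ℝ :=
  ∑' v : L, Real.exp (-(Real.pi * y) * ‖(v : EuclideanSpace ℝ (Fin n))‖ ^ 2)

lemma thetaL_eq_thetaR {n : ℕ} (L : Submodule ℤ (EuclideanSpace ℝ (Fin n))) (y : ℝ) :
    thetaL L 0 (Complex.I * y) = (thetaR L y : ℂ) := by
  unfold thetaL thetaR
  rw [Complex.ofReal_tsum]
  refine tsum_congr fun v => ?_
  rw [add_zero, ← mul_assoc, Complex.I_mul_I]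
  push_cast
  congr 1
  ring

open Filter Topology in
lemma thetaR_limit {n : ℕ} {L : Submodule ℤ (EuclideanSpace ℝ (Fin n))}
    (hL : IsUnimodularLattice n L) :
    Tendsto (fun y : ℝ => (thetaR L y - 1) * Real.exp (Real.pi * y)) atTop
      (𝓝 (∑' v : L, if ‖(v : EuclideanSpace ℝ (Fin n))‖ = 1 then (1 : ℝ) else 0)) := by
  classical
  have i1 := hL.1
  have hpi := Real.pi_pos
  have hnorm : ∀ v : L, v ≠ 0 → 1 ≤ ‖(v : EuclideanSpace ℝ (Fin n))‖ ^ 2 ∧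
      (‖(v : EuclideanSpace ℝ (Fin n))‖ ≠ 1 → 2 ≤ ‖(v : EuclideanSpace ℝ (Fin n))‖ ^ 2) := by
    intro v hv
    obtain ⟨k, hk⟩ := norm_sq_int hL v
    have h0 : 0 < ‖(v : EuclideanSpace ℝ (Fin n))‖ := by
      rw [norm_pos_iff]
      simpa using hv
    have hk0 : 0 < k := by
      have : 0 < ‖(v : EuclideanSpace ℝ (Fin n))‖ ^ 2 := by positivity
      rw [hk] at this
      exact_mod_cast this
    rw [hk]
    refine ⟨by exact_mod_cast hk0, fun h1 => ?_⟩
    have : k ≠ 1 := by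
      rintro rfl
      apply h1
      have : ‖(v : EuclideanSpace ℝ (Fin n))‖ ^ 2 = 1 := by simpa using hk
      nlinarith
    have : 2 ≤ k := by omega
    exact_mod_cast this
  have hrw : ∀ y : ℝ, 0 < y → (∑' v : L, if v = 0 then (0 : ℝ) else
      Real.exp (-(Real.pi * y) * (‖(v : EuclideanSpace ℝ (Fin n))‖ ^ 2 - 1))) =
      (thetaR L y - 1) * Real.exp (Real.pi * y) := by
    intro y hy
    have hs := summable_gauss0 L (mul_pos hpi hy)
    have h1 := hs.tsum_eq_add_tsum_ite (0 : L)
    unfold thetaR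
    rw [h1]
    simp only [ZeroMemClass.coe_zero, norm_zero]
    rw [show Real.exp (-(Real.pi * y) * 0 ^ 2) = 1 by simp, add_sub_cancel_left, ← tsum_mul_right]
    refine tsum_congr fun v => ?_
    split_ifs with hv
    · simp
    · rw [← Real.exp_add]
      congr 1
      ring
  have hev : ∀ᶠ y : ℝ in atTop, (∑' v : L, if v = 0 then (0 : ℝ) else
      Real.exp (-(Real.pi * y) * (‖(v : EuclideanSpace ℝ (Fin n))‖ ^ 2 - 1))) =
      (thetaR L y - 1) * Real.exp (Real.pi * y) := by
    filter_upwards [eventually_gt_atTop 0] with y hy using hrw y hy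
  refine Tendsto.congr' hev ?_
  refine tendsto_tsum_of_dominated_convergence
    ((summable_gauss0 L Real.pi_pos).mul_left (Real.exp Real.pi)) (fun v => ?_) ?_
  · by_cases hv : v = 0
    · subst hv
      simp
    · simp only [hv, if_false]
      split_ifs with h1
      · simp [h1]
      · have h2 := (hnorm v hv).2 h1
        apply Real.tendsto_exp_atBot.comp
        have : Tendsto (fun y : ℝ => y * (Real.pi * (‖(v : EuclideanSpace ℝ (Fin n))‖ ^ 2 - 1)))
            atTop atTop := by
          apply Tendsto.atTop_mul_const _ tendsto_id
          apply mul_pos hpi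
          linarith
        refine (tendsto_neg_atTop_atBot.comp this).congr fun y => ?_
        simp only [Function.comp]
        ring
  · filter_upwards [eventually_ge_atTop 1] with y hy v
    split_ifs with hv
    · rw [norm_zero]
      positivity
    · have h1 := (hnorm v hv).1
      rw [Real.norm_eq_abs, Real.abs_exp, ← Real.exp_add]
      apply Real.exp_le_exp.mpr
      have h3 : 0 ≤ (‖(v : EuclideanSpace ℝ (Fin n))‖ ^ 2 - 1) * (y - 1) :=
        mul_nonneg (by linarith) (by linarith)
      nlinarith

lemma unit_count_eq {n : ℕ} {L L' : Submodule ℤ (EuclideanSpace ℝ (Fin n))}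
    (hL : IsUnimodularLattice n L) (hL' : IsUnimodularLattice n L')
    (H : ∀ t : ℂ, 0 < t.im → thetaL L 0 t ^ 8 = thetaL L' 0 t ^ 8) :
    (∑' v : L, if ‖(v : EuclideanSpace ℝ (Fin n))‖ = 1 then (1 : ℝ) else 0) =
    ∑' v : L', if ‖(v : EuclideanSpace ℝ (Fin n))‖ = 1 then (1 : ℝ) else 0 := by
  refine tendsto_nhds_unique (thetaR_limit hL) ((thetaR_limit hL').congr' ?_)
  filter_upwards [Filter.eventually_gt_atTop 0] with y hy
  have h1 := H (Complex.I * y) (by simpa using hy)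
  rw [thetaL_eq_thetaR, thetaL_eq_thetaR] at h1
  have h2 : thetaR L y ^ 8 = thetaR L' y ^ 8 := by exact_mod_cast h1
  have h3 : thetaR L y = thetaR L' y :=
    (pow_left_inj₀ (tsum_nonneg fun _ => (Real.exp_pos _).le)
      (tsum_nonneg fun _ => (Real.exp_pos _).le) (by norm_num)).mp h2
  rw [h3]

lemma zn_count (n : ℕ) : (2 * n : ℝ) ≤
    ∑' v : (Submodule.span ℤ (Set.range (EuclideanSpace.basisFun (Fin n) ℝ))),
      if ‖(v : EuclideanSpace ℝ (Fin n))‖ = 1 then (1 : ℝ) else 0 := by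
  classical
  have hU := zn_unimodular n
  have i1 := hU.1
  set Z := Submodule.span ℤ (Set.range (EuclideanSpace.basisFun (Fin n) ℝ)) with hZ
  have hmem : ∀ i, EuclideanSpace.basisFun (Fin n) ℝ i ∈ Z := fun i =>
    Submodule.subset_span ⟨i, rfl⟩
  let f : Fin n ⊕ Fin n → Z := Sum.elim (fun i => ⟨_, hmem i⟩) (fun i => -⟨_, hmem i⟩)
  have hf1 : ∀ x, ‖(f x : EuclideanSpace ℝ (Fin n))‖ = 1 := by
    rintro (i | i) <;> simp [f]
  have hinj : Function.Injective f := by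
    rintro (i | i) (j | j) hij
    · have := congrArg (fun v : Z => (v : EuclideanSpace ℝ (Fin n)) i) hij
      by_contra hne
      have hne' : i ≠ j := fun hh => hne (by rw [hh])
      simp [f, hne'] at this
    · have := congrArg (fun v : Z => (v : EuclideanSpace ℝ (Fin n)) i) hij
      by_cases hne : i = j
      · subst hne
        simp [f] at this
        norm_num at this
      · simp [f, hne] at this
    · have := congrArg (fun v : Z => (v : EuclideanSpace ℝ (Fin n)) i) hij
      by_cases hne : i = j
      · subst hne
        simp [f] at this
        norm_num at this
      · simp [f, hne] at this
    · have := congrArg (fun v : Z => (v : EuclideanSpace ℝ (Fin n)) i) hij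
      by_contra hne
      have hne' : i ≠ j := fun hh => hne (by rw [hh])
      simp [f, hne'] at this
  have h1 := (unit_summable Z).sum_le_tsum (Finset.univ.map ⟨f, hinj⟩) (fun v _ => by
    split_ifs <;> norm_num)
  refine le_trans ?_ h1
  rw [Finset.sum_map]
  simp [hf1]
  linarith

lemma finish_aux {n : ℕ} {L : Submodule ℤ (EuclideanSpace ℝ (Fin n))}
    (hL : IsUnimodularLattice n L)
    (hc : (2 * n : ℝ) ≤ ∑' v : L, if ‖(v : EuclideanSpace ℝ (Fin n))‖ = 1 then (1 : ℝ) else 0) :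
    ∃ e : Fin n → EuclideanSpace ℝ (Fin n),
      Orthonormal ℝ e ∧ L = Submodule.span ℤ (Set.range e) := by
  classical
  have i1 := hL.1
  have hfin := unit_finite L
  set F : Finset (EuclideanSpace ℝ (Fin n)) := hfin.toFinset.map ⟨Subtype.val, Subtype.val_injective⟩
    with hF
  have hFmem : ∀ v, v ∈ F ↔ v ∈ L ∧ ‖v‖ = 1 := by
    intro v
    simp [hF]
    tauto
  have hcard : 2 * n ≤ F.card := by
    rw [tsum_eq_sum (s := hfin.toFinset) (fun v hv => by
      have : ‖(v : EuclideanSpace ℝ (Fin n))‖ ≠ 1 := by simpa using hv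
      simp only [this, if_false])] at hc
    rw [Finset.sum_congr rfl (g := fun _ => (1 : ℝ)) (fun v hv => by
      have : ‖(v : EuclideanSpace ℝ (Fin n))‖ = 1 := by simpa using hv
      simp only [this, if_true])] at hc
    rw [Finset.sum_const, nsmul_eq_mul, mul_one] at hc
    rw [hF, Finset.card_map]
    exact_mod_cast hc
  obtain ⟨s, hs, hmax⟩ := Finset.exists_max_image
    (F.powerset.filter fun s => ∀ a ∈ s, ∀ b ∈ s, a ≠ b → ⟪a, b⟫ = 0) Finset.card ⟨∅, by simp⟩
  rw [Finset.mem_filter, Finset.mem_powerset] at hs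
  obtain ⟨hsF, hso⟩ := hs
  have hsub : F ⊆ s ∪ s.image (fun x => -x) := by
    intro v hv
    have hv1 := (hFmem v).mp hv
    by_contra hnot
    have horth : ∀ a ∈ s, ⟪a, v⟫ = 0 := by
      intro a ha
      have ha1 := (hFmem a).mp (hsF ha)
      obtain ⟨k, hk⟩ := inner_int_aux hL ha1.1 hv1.1
      have habs := abs_real_inner_le_norm a v
      rw [ha1.2, hv1.2, hk, mul_one, ← Int.cast_abs] at habs
      have habs' : |k| ≤ 1 := by exact_mod_cast habs
      rw [abs_le] at habs'
      have h3 : k = -1 ∨ k = 0 ∨ k = 1 := by omega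
      rcases h3 with rfl | rfl | rfl
      · exfalso
        apply hnot
        have : a = -v := (inner_eq_one_iff_of_norm_eq_one (𝕜 := ℝ) ha1.2
          (by rw [norm_neg]; exact hv1.2)).mp (by rw [inner_neg_right, hk]; norm_num)
        rw [Finset.mem_union]
        right
        rw [Finset.mem_image]
        exact ⟨a, ha, by rw [this, neg_neg]⟩
      · simpa using hk
      · exfalso
        apply hnot
        have : a = v := (inner_eq_one_iff_of_norm_eq_one (𝕜 := ℝ) ha1.2 hv1.2).mp
          (by rw [hk]; norm_num)
        rw [Finset.mem_union]
        left
        rwa [← this]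
    have hvs : v ∉ s := fun h => hnot (Finset.mem_union_left _ h)
    have := hmax (insert v s) (by
      rw [Finset.mem_filter, Finset.mem_powerset]
      refine ⟨Finset.insert_subset hv hsF, ?_⟩
      intro a ha b hb hab
      rw [Finset.mem_insert] at ha hb
      rcases ha with rfl | ha <;> rcases hb with rfl | hb
      · exact absurd rfl hab
      · rw [real_inner_comm]; exact horth b hb
      · exact horth a ha
      · exact hso a ha b hb hab)
    rw [Finset.card_insert_of_notMem hvs] at this
    omega
  have hge : n ≤ s.card := by
    have h1 := Finset.card_le_card hsub
    have h2 := Finset.card_union_le s (s.image (fun x => -x))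
    have h3 : (s.image (fun x => -x)).card ≤ s.card := Finset.card_image_le
    omega
  have hON : Orthonormal ℝ (fun a : s => (a : EuclideanSpace ℝ (Fin n))) := by
    refine ⟨fun a => ((hFmem a).mp (hsF a.2)).2, fun a b hab => ?_⟩
    exact hso a a.2 b b.2 (fun h => hab (Subtype.ext h))
  have hle : s.card ≤ n := by
    have := hON.linearIndependent.fintype_card_le_finrank
    simpa using this
  have hcs : s.card = n := le_antisymm hle hge
  let φ : Fin n ≃ s := (finCongr hcs.symm).trans s.equivFin.symm
  have hONe : Orthonormal ℝ (fun i => (φ i : EuclideanSpace ℝ (Fin n))) :=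
    hON.comp φ φ.injective
  refine ⟨fun i => (φ i : EuclideanSpace ℝ (Fin n)), hONe, ?_⟩
  have heL : ∀ i, (φ i : EuclideanSpace ℝ (Fin n)) ∈ L := fun i =>
    ((hFmem _).mp (hsF (φ i).2)).1
  apply le_antisymm
  · intro v hv
    have hspan : ⊤ ≤ Submodule.span ℝ (Set.range fun i => (φ i : EuclideanSpace ℝ (Fin n))) := by
      rw [hONe.linearIndependent.span_eq_top_of_card_eq_finrank' (by simp)]
    let b := OrthonormalBasis.mk hONe hspan
    have hv2 := b.sum_repr' v
    rw [← hv2]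
    refine Submodule.sum_mem _ fun i _ => ?_
    have hbi : b i = (φ i : EuclideanSpace ℝ (Fin n)) := by simp [b]
    rw [hbi]
    obtain ⟨k, hk⟩ := inner_int_aux hL (heL i) hv
    rw [hk, Int.cast_smul_eq_zsmul]
    exact Submodule.smul_mem _ _ (Submodule.subset_span ⟨i, rfl⟩)
  · rw [Submodule.span_le]
    rintro _ ⟨i, rfl⟩
    exact heL i

/-- If every characteristic vector of a unimodular lattice `L ⊆ ℝⁿ` has norm at least `n`,
then `L` is isometric to the standard lattice `ℤⁿ`: it is the `ℤ`-span of an orthonormal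
basis of `ℝⁿ`. -/
theorem eq_zn_of_characteristic_norm_ge (n : ℕ)
    (L : Submodule ℤ (EuclideanSpace ℝ (Fin n))) (hL : IsUnimodularLattice n L)
    (h : ∀ w : EuclideanSpace ℝ (Fin n), IsCharacteristic n L w → (n : ℝ) ≤ ⟪w, w⟫) :
    ∃ e : Fin n → EuclideanSpace ℝ (Fin n),
      Orthonormal ℝ e ∧ L = Submodule.span ℤ (Set.range e) := by
  apply finish_aux hL
  rw [unit_count_eq hL (zn_unimodular n)
    (theta_comparison hL h (zn_unimodular n) (zn_char n))]
  exact zn_count n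
end
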